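/- arXiv:1808.10749 — 2 statements merged into one kernel-verified Lean document; each statement's English description precedes it below -/
import Mathlib

section
/- Let X be a compact Hausdorff space and let r : I_f(X) → δ(X) be the map sending μ = ⊕_{i=1}^n λ_i ⊙ δ_{x_i} to δ_{x_{i_0}}, where i_0 is the unique index with λ_{i_0} = 0. Then r is an open map: the image under r of every open subset of I_f(X) is open in δ(X). -/
open Real Set Topology

/-- The Dirac measure `δ_x` on `X`, as a functional on `C(X, ℝ)`: `δ_x(φ) = φ(x)`. -/
def dirac (X : Type*) [TopologicalSpace X] (x : X) : C(X, ℝ) → ℝ := fun φ => φ x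

/-- The max-plus combination `⊕_{i=1}^n λ_i ⊙ δ_{x_i}`, i.e. the functional
`φ ↦ max_{1 ≤ i ≤ n} (λ_i + φ(x_i))`. -/
noncomputable def maxPlus {X : Type*} [TopologicalSpace X] {n : ℕ}
    (lam : Fin n → ℝ) (x : Fin n → X) : C(X, ℝ) → ℝ :=
  fun φ => ⨆ i, (lam i + φ (x i))

/-- `μ : C(X, ℝ) → ℝ` is an idempotent probability measure:
(1) `μ(c_λ) = λ` for constant functions; (2) `μ(λ + φ) = λ + μ(φ)`;
(3) `μ(max(φ, ψ)) = max(μ(φ), μ(ψ))`. -/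
def IsIPM {X : Type*} [TopologicalSpace X] (μ : C(X, ℝ) → ℝ) : Prop :=
  (∀ c : ℝ, μ (ContinuousMap.const X c) = c) ∧
  (∀ (c : ℝ) (φ : C(X, ℝ)), μ (ContinuousMap.const X c + φ) = c + μ φ) ∧
  (∀ φ ψ : C(X, ℝ), μ (φ ⊔ ψ) = max (μ φ) (μ ψ))

/-- Membership in `I_ω(X)`: idempotent probability measures with finite support, i.e.
`μ = ⊕_{i=1}^n λ_i ⊙ δ_{x_i}` with `x_i` pairwise distinct, `λ_i ≤ 0` and `max_i λ_i = 0`. -/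
def IsFS {X : Type*} [TopologicalSpace X] (μ : C(X, ℝ) → ℝ) : Prop :=
  ∃ n : ℕ, 0 < n ∧ ∃ (x : Fin n → X) (lam : Fin n → ℝ),
    Function.Injective x ∧ (∀ i, lam i ≤ 0) ∧ (∃ i, lam i = 0) ∧ μ = maxPlus lam x

/-- Membership in `I_f(X)`: `μ = ⊕_{i=1}^n λ_i ⊙ δ_{x_i}` with `x_i` pairwise distinct,
a unique index `i₀` with `λ_{i₀} = 0`, and `λ_i ≤ -ln(n+1)` for every `i ≠ i₀`. -/
def IsIf {X : Type*} [TopologicalSpace X] (μ : C(X, ℝ) → ℝ) : Prop :=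
  ∃ n : ℕ, 0 < n ∧ ∃ (x : Fin n → X) (lam : Fin n → ℝ) (i0 : Fin n),
    Function.Injective x ∧ lam i0 = 0 ∧
    (∀ i, i ≠ i0 → lam i ≤ -Real.log (n + 1)) ∧ μ = maxPlus lam x

lemma maxPlus_continuous {X : Type*} [TopologicalSpace X] {n : ℕ} (hn : 0 < n)
    (lam : Fin n → ℝ) : Continuous (fun x : Fin n → X => maxPlus lam x) := by
  haveI : Nonempty (Fin n) := ⟨⟨0, hn⟩⟩
  refine continuous_pi fun φ => ?_
  unfold maxPlus
  simp only [← Finset.sup'_univ_eq_ciSup]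
  refine Continuous.finset_sup'_apply _ fun i _ => ?_
  exact continuous_const.add (φ.continuous.comp (continuous_apply i))

lemma dirac_isHomeo {X : Type*} [TopologicalSpace X] [CompactSpace X] [T2Space X] :
    IsOpenMap (fun x : X =>
      (⟨dirac X x, x, rfl⟩ : {μ : C(X, ℝ) → ℝ // ∃ x : X, μ = dirac X x})) := by
  have hc : Continuous (fun x : X =>
      (⟨dirac X x, x, rfl⟩ : {μ : C(X, ℝ) → ℝ // ∃ x : X, μ = dirac X x})) :=
    Continuous.subtype_mk (continuous_pi fun φ => φ.continuous) _
  have hb : Function.Bijective (fun x : X =>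
      (⟨dirac X x, x, rfl⟩ : {μ : C(X, ℝ) → ℝ // ∃ x : X, μ = dirac X x})) := by
    constructor
    · intro a b hab
      by_contra hne
      have h1 : dirac X a = dirac X b := congrArg Subtype.val hab
      obtain ⟨f, h0, h2, -⟩ := exists_continuous_zero_one_of_isClosed
        (isClosed_singleton (x := a)) (isClosed_singleton (x := b)) (by simpa using hne)
      have h3 : f a = f b := congrFun h1 f
      have h4 : f a = 0 := h0 rfl
      have h5 : f b = 1 := h2 rfl
      rw [h4, h5] at h3
      exact zero_ne_one h3
    · rintro ⟨μ, x, rfl⟩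
      exact ⟨x, rfl⟩
  exact (hc.homeoOfEquivCompactToT2 (f := Equiv.ofBijective _ hb)).isOpenMap

/-- the retraction `r : I_f(X) → δ(X)` (sending
`μ = ⊕_{i=1}^n λ_i ⊙ δ_{x_i}` to `δ_{x_{i₀}}`, `i₀` the unique index with `λ_{i₀} = 0`)
is an open map: images of open subsets of `I_f(X)` are open in `δ(X)`. -/
theorem stmt5 {X : Type*} [TopologicalSpace X] [CompactSpace X] [T2Space X]
    (r : {μ : C(X, ℝ) → ℝ // IsIf μ} → {μ : C(X, ℝ) → ℝ // ∃ x : X, μ = dirac X x})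
    (hr : ∀ (n : ℕ), 0 < n → ∀ (x : Fin n → X) (lam : Fin n → ℝ) (i0 : Fin n),
      Function.Injective x → lam i0 = 0 →
      (∀ i, i ≠ i0 → lam i ≤ -Real.log (n + 1)) →
      ∀ hμ : IsIf (maxPlus lam x),
        (r ⟨maxPlus lam x, hμ⟩ : C(X, ℝ) → ℝ) = dirac X (x i0)) :
    IsOpenMap r := by
  intro U hU
  rw [isOpen_iff_mem_nhds]
  rintro _ ⟨⟨μ, hμ⟩, hμU, rfl⟩
  obtain ⟨n, hn, x, lam, i0, hx, h0, hl, rfl⟩ := id hμ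
  let V : Set X := {y | ∀ i, i ≠ i0 → x i ≠ y}
  have hV : IsOpen V := by
    have : V = (x '' {i | i ≠ i0})ᶜ := by
      ext y; simp [V]
    rw [this]
    exact ((Set.toFinite _).image x).isClosed.isOpen_compl
  have hinj : ∀ y ∈ V, Function.Injective (Function.update x i0 y) := by
    intro y hy i j hij
    by_cases hi : i = i0 <;> by_cases hj : j = i0
    · rw [hi, hj]
    · subst hi
      simp [hj] at hij
      exact absurd hij.symm (hy j hj)
    · subst hj
      simp [hi] at hij
      exact absurd hij (hy i hi)
    · simp [hi, hj] at hij
      exact hx hij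
  have hF : ∀ y : V, IsIf (maxPlus lam (Function.update x i0 y.1)) := fun y =>
    ⟨n, hn, _, lam, i0, hinj y.1 y.2, h0, hl, rfl⟩
  let F : V → {μ : C(X, ℝ) → ℝ // IsIf μ} := fun y => ⟨_, hF y⟩
  have hFc : Continuous F := by
    refine Continuous.subtype_mk ?_ _
    exact (maxPlus_continuous hn lam).comp
      (continuous_const.update i0 continuous_subtype_val)
  have hW : IsOpen (Subtype.val '' (F ⁻¹' U)) :=
    hV.isOpenMap_subtype_val _ (hU.preimage hFc)
  have hD := dirac_isHomeo _ hW
  refine Filter.mem_of_superset (hD.mem_nhds ?_) ?_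
  · have hx0 : x i0 ∈ V := fun i hi h => hi (hx h)
    refine ⟨x i0, ⟨⟨x i0, hx0⟩, ?_, rfl⟩, ?_⟩
    · have : F ⟨x i0, hx0⟩ = ⟨maxPlus lam x, hμ⟩ := by
        apply Subtype.ext
        simp [F]
      rw [Set.mem_preimage, this]
      exact hμU
    · exact Subtype.ext (hr n hn x lam i0 hx h0 hl hμ).symm
  · rintro _ ⟨_, ⟨y, hy, rfl⟩, rfl⟩
    refine ⟨F y, hy, ?_⟩
    apply Subtype.ext
    have := hr n hn _ lam i0 (hinj y.1 y.2) h0 hl (hF y)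
    simpa using this
end

section
/- Let X be a compact metrizable space which is an absolute neighborhood retract (ANR): whenever X is homeomorphic to a closed subspace X' of a compact metrizable space Z, there exist an open set U ⊆ Z with X' ⊆ U and a continuous retraction U → X'. Then I_f(X) is also a compact metrizable absolute neighborhood retract. -/
open Real Set Topology

universe u

/-- A compact metrizable space `A` is an absolute neighborhood retract (ANR) if whenever
`A` is homeomorphic to a closed subspace `A'` of a compact metrizable space `Z`, there
exist an open set `U ⊆ Z` with `A' ⊆ U` and a continuous retraction `U → A'`. -/
def IsCompactANR (A : Type u) [TopologicalSpace A] : Prop :=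
  ∀ (Z : Type u) [TopologicalSpace Z] [CompactSpace Z]
    [TopologicalSpace.MetrizableSpace Z] (A' : Set Z),
    IsClosed A' → Nonempty (A ≃ₜ A') →
    ∃ U : Set Z, IsOpen U ∧ A' ⊆ U ∧
      ∃ ρ : C(U, Z), (∀ u : U, ρ u ∈ A') ∧ ∀ u : U, (u : Z) ∈ A' → ρ u = (u : Z)

structure IfRep {X : Type*} [TopologicalSpace X] (μ : C(X, ℝ) → ℝ) where
  n : ℕ
  x : Fin n → X
  h : Fin n → ℝ
  i0 : Fin n
  pos : ∀ i, 0 < h i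
  main : h i0 = 1
  small : ∀ i, i ≠ i0 → h i ≤ 1 / ((n : ℝ) + 1)
  le : ∀ (φ : C(X, ℝ)) i, h i * exp (φ (x i)) ≤ exp (μ φ)
  ex : ∀ φ : C(X, ℝ), ∃ i, exp (μ φ) = h i * exp (φ (x i))

theorem IfRep.le_one {X : Type*} [TopologicalSpace X] {μ : C(X, ℝ) → ℝ} (R : IfRep μ) (i) :
    R.h i ≤ 1 := by
  by_cases hi : i = R.i0
  · rw [hi, R.main]
  · refine (R.small i hi).trans ?_
    rw [div_le_one (by positivity)]
    have : (0:ℝ) ≤ R.n := by positivity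
    linarith

theorem IfRep.le_third {X : Type*} [TopologicalSpace X] {μ : C(X, ℝ) → ℝ} (R : IfRep μ) (i)
    (hi : i ≠ R.i0) : R.h i ≤ 1 / 3 := by
  refine (R.small i hi).trans ?_
  have h1 : 2 ≤ R.n := by
    have := i.2
    have := R.i0.2
    by_contra h
    apply hi
    ext
    omega
  have : (2:ℝ) ≤ R.n := by exact_mod_cast h1
  apply one_div_le_one_div_of_le <;> linarith

theorem exists_rep {X : Type*} [TopologicalSpace X] {μ : C(X, ℝ) → ℝ} (hμ : IsIf μ) :
    Nonempty (IfRep μ) := by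
  obtain ⟨n, hn, x, lam, i0, -, h0, hs, rfl⟩ := hμ
  refine ⟨⟨n, x, fun i => exp (lam i), i0, fun i => exp_pos _, by simp [h0], ?_, ?_, ?_⟩⟩
  · intro i hi
    have := exp_le_exp.2 (hs i hi)
    rwa [exp_neg, exp_log (by positivity), ← one_div] at this
  · intro φ i
    rw [← exp_add, exp_le_exp]
    exact le_ciSup (f := fun i => lam i + φ (x i)) (Set.finite_range _).bddAbove i
  · intro φ
    have : Nonempty (Fin n) := ⟨i0⟩
    obtain ⟨i, hi⟩ := exists_eq_ciSup_of_finite (f := fun i => lam i + φ (x i))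
    refine ⟨i, ?_⟩
    rw [← exp_add]
    exact congrArg exp hi.symm

theorem crit_bdd {X : Type*} [TopologicalSpace X] [CompactSpace X] {W : Type*}
    (κ : W → ℝ) (G : W → X) (h0 : ∀ w, 0 ≤ κ w) (h1 : ∀ w, κ w ≤ 1) (φ : C(X, ℝ)) :
    BddAbove (range fun w => κ w * exp (φ (G w))) := by
  refine ⟨exp ‖φ‖, ?_⟩
  rintro _ ⟨w, rfl⟩
  calc κ w * exp (φ (G w)) ≤ 1 * exp ‖φ‖ := by
        have := (le_abs_self _).trans (φ.norm_coe_le_norm (G w))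
        have := h0 w
        have := h1 w
        gcongr
    _ = _ := one_mul _

theorem crit {X : Type*} [TopologicalSpace X] [CompactSpace X] {W ι : Type*} [Fintype ι]
    (κ : W → ℝ) (G : W → X) (l : W → ι) (i0 : ι) (w0 : W) (hl0 : l w0 = i0) (hκ0 : κ w0 = 1)
    (h0 : ∀ w, 0 ≤ κ w) (h1 : ∀ w, κ w ≤ 1)
    (hG : ∀ w w', 0 < κ w → 0 < κ w' → l w = l w' → G w = G w')
    (hle : ∀ w, 0 < κ w → l w ≠ i0 → κ w ≤ 1 / ((Fintype.card ι : ℝ) + 1))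
    (μ : C(X, ℝ) → ℝ) (hμ : ∀ φ, exp (μ φ) = ⨆ w, κ w * exp (φ (G w))) : IsIf μ := by
  classical
  have : Nonempty W := ⟨w0⟩
  have hY : ∃ Y : ι → X, (∀ i, ∃ w, 0 < κ w ∧ G w = Y i) ∧ ∀ w, 0 < κ w → G w = Y (l w) := by
    refine ⟨fun i => if h : ∃ w, 0 < κ w ∧ l w = i then G h.choose else G w0, ?_, ?_⟩
    · intro i
      by_cases h : ∃ w, 0 < κ w ∧ l w = i
      · exact ⟨h.choose, h.choose_spec.1, by simp only [dif_pos h]⟩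
      · exact ⟨w0, by rw [hκ0]; norm_num, by simp only [dif_neg h]⟩
    · intro w hw
      have h : ∃ w', 0 < κ w' ∧ l w' = l w := ⟨w, hw, rfl⟩
      simp only [dif_pos h]
      exact hG _ _ hw h.choose_spec.1 h.choose_spec.2.symm
  obtain ⟨Y, hY1, hY2⟩ := hY
  set P : Finset X := Finset.univ.image Y with hP
  have hPc : P.card ≤ Fintype.card ι := Finset.card_image_le.trans (by simp)
  have hP1 : ∀ p ∈ P, ∃ w, 0 < κ w ∧ G w = p := by
    intro p hp
    obtain ⟨i, -, rfl⟩ := Finset.mem_image.1 hp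
    exact hY1 i
  have hP2 : ∀ w, 0 < κ w → G w ∈ P := by
    intro w hw
    rw [hY2 w hw]
    exact Finset.mem_image_of_mem _ (Finset.mem_univ _)
  have hw0 : 0 < κ w0 := by rw [hκ0]; norm_num
  set k : X → ℝ := fun p => ⨆ w, if G w = p then κ w else 0 with hk
  have hkb : ∀ p, BddAbove (range fun w => if G w = p then κ w else 0) := by
    intro p
    refine ⟨1, ?_⟩
    rintro _ ⟨w, rfl⟩
    dsimp only
    split_ifs
    · exact h1 w
    · norm_num
  have hkle : ∀ w, κ w ≤ k (G w) := by
    intro w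
    have := le_ciSup (hkb (G w)) w
    simpa using this
  have hkpos : ∀ p ∈ P, 0 < k p := by
    intro p hp
    obtain ⟨w, hw, rfl⟩ := hP1 p hp
    exact hw.trans_le (hkle w)
  have hk0 : k (G w0) = 1 := by
    apply le_antisymm
    · apply ciSup_le
      intro w
      split_ifs
      · exact h1 w
      · norm_num
    · rw [← hκ0]; exact hkle w0
  have hks : ∀ p, p ≠ G w0 → k p ≤ 1 / ((Fintype.card ι : ℝ) + 1) := by
    intro p hp
    apply ciSup_le
    intro w
    have : (0:ℝ) ≤ 1 / ((Fintype.card ι : ℝ) + 1) := by positivity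
    split_ifs with h
    · rcases (h0 w).eq_or_lt with h' | h'
      · rw [← h']; exact this
      · apply hle w h'
        intro hi
        apply hp
        rw [← h]
        exact hG _ _ h' hw0 (hi.trans hl0.symm)
    · exact this
  let e := P.equivFin.symm
  have hn : 0 < P.card := Finset.card_pos.2 ⟨_, hP2 w0 hw0⟩
  have hcard : (P.card : ℝ) ≤ Fintype.card ι := by exact_mod_cast hPc
  refine ⟨P.card, hn, fun i => (e i).1, fun i => log (k (e i).1),
    e.symm ⟨G w0, hP2 w0 hw0⟩, ?_, ?_, ?_, ?_⟩
  · exact Subtype.val_injective.comp e.injective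
  · simp [hk0]
  · intro i hi
    have h2 : ((e i).1) ≠ G w0 := by
      intro h
      apply hi
      rw [Equiv.eq_symm_apply]
      exact Subtype.ext h
    have h3 := hks _ h2
    have h4 := hkpos _ (e i).2
    rw [← log_inv]
    apply log_le_log h4
    refine h3.trans ?_
    rw [one_div]
    gcongr
  · funext φ
    have : Nonempty (Fin P.card) := ⟨⟨0, hn⟩⟩
    have hexp : ∀ i : Fin P.card, exp (log (k (e i).1) + φ (e i).1)
        = k (e i).1 * exp (φ (e i).1) := by
      intro i
      rw [exp_add, exp_log (hkpos _ (e i).2)]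
    apply le_antisymm
    · rw [← exp_le_exp, hμ]
      apply ciSup_le
      intro w
      rcases (h0 w).eq_or_lt with h' | h'
      · rw [← h', zero_mul]; exact (exp_pos _).le
      · have hh := le_ciSup (f := fun i => log (k (e i).1) + φ (e i).1)
          (Set.finite_range _).bddAbove (e.symm ⟨G w, hP2 w h'⟩)
        have hh2 := exp_le_exp.2 hh
        rw [hexp] at hh2
        refine le_trans ?_ hh2
        simp only [Equiv.apply_symm_apply]
        exact mul_le_mul_of_nonneg_right (hkle w) (exp_pos _).le
    · unfold maxPlus
      apply ciSup_le
      intro i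
      rw [← exp_le_exp, hexp, ← le_div_iff₀ (exp_pos _)]
      apply ciSup_le
      intro w
      split_ifs with h
      · rw [le_div_iff₀ (exp_pos _), hμ, ← h]
        exact le_ciSup (crit_bdd κ G h0 h1 φ) w
      · positivity

/-- the extension of `exp μ log` to non-negative functions -/
noncomputable def hat {X : Type*} [TopologicalSpace X] (y : {μ : C(X, ℝ) → ℝ // IsIf μ})
    (ψ : C(X, ℝ)) : ℝ :=
  ⨆ i, (exists_rep y.2).some.h i * ψ ((exists_rep y.2).some.x i)

noncomputable def theRep {X : Type*} [TopologicalSpace X] (y : {μ : C(X, ℝ) → ℝ // IsIf μ}) :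
    IfRep y.1 := (exists_rep y.2).some

theorem le_hat {X : Type*} [TopologicalSpace X] (y : {μ : C(X, ℝ) → ℝ // IsIf μ})
    (ψ : C(X, ℝ)) (i) : (theRep y).h i * ψ ((theRep y).x i) ≤ hat y ψ :=
  le_ciSup (f := fun i => (theRep y).h i * ψ ((theRep y).x i)) (Set.finite_range _).bddAbove i

theorem ex_hat {X : Type*} [TopologicalSpace X] (y : {μ : C(X, ℝ) → ℝ // IsIf μ})
    (ψ : C(X, ℝ)) : ∃ i, hat y ψ = (theRep y).h i * ψ ((theRep y).x i) := by
  have : Nonempty (Fin (theRep y).n) := ⟨(theRep y).i0⟩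
  obtain ⟨i, hi⟩ := exists_eq_ciSup_of_finite
    (f := fun i => (theRep y).h i * ψ ((theRep y).x i))
  exact ⟨i, hi.symm⟩

theorem hat_exp {X : Type*} [TopologicalSpace X] (y : {μ : C(X, ℝ) → ℝ // IsIf μ})
    (φ ψ : C(X, ℝ)) (h : ∀ x, ψ x = exp (φ x)) : hat y ψ = exp (y.1 φ) := by
  apply le_antisymm
  · obtain ⟨i, hi⟩ := ex_hat y ψ
    rw [hi, h]
    exact (theRep y).le φ i
  · obtain ⟨i, hi⟩ := (theRep y).ex φ
    rw [hi, ← h]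
    exact le_hat y ψ i

theorem hat_lip {X : Type*} [TopologicalSpace X] (y : {μ : C(X, ℝ) → ℝ // IsIf μ})
    (ψ ψ' : C(X, ℝ)) (c : ℝ) (hc : 0 ≤ c) (h : ∀ x, ψ x ≤ ψ' x + c) :
    hat y ψ ≤ hat y ψ' + c := by
  obtain ⟨i, hi⟩ := ex_hat y ψ
  rw [hi]
  have h1 := le_hat y ψ' i
  have h2 := (theRep y).le_one i
  have h3 := (theRep y).pos i
  have h4 := h ((theRep y).x i)
  nlinarith

theorem hat_cont {X : Type*} [TopologicalSpace X] (ψ : C(X, ℝ)) (hψ : ∀ x, 0 ≤ ψ x) :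
    Continuous fun y : {μ : C(X, ℝ) → ℝ // IsIf μ} => hat y ψ := by
  rw [continuous_iff_continuousAt]
  intro y0
  rw [Metric.continuousAt_iff']
  intro ε hε
  have hpos : ∀ x, 0 < ψ x + ε / 4 := fun x => by have := hψ x; linarith
  let φ : C(X, ℝ) := ⟨fun x => log (ψ x + ε / 4),
    Continuous.log (by fun_prop) (fun x => (hpos x).ne')⟩
  let ψ' : C(X, ℝ) := ⟨fun x => ψ x + ε / 4, by fun_prop⟩
  have h1 : ∀ y, hat y ψ' = exp (y.1 φ) := fun y =>
    hat_exp y φ ψ' (fun x => by simp [φ, ψ', exp_log (hpos x)])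
  have h2 : ∀ y, hat y ψ' ≤ hat y ψ + ε / 4 := fun y => hat_lip y _ _ _ (by linarith)
    (fun x => le_rfl)
  have h3 : ∀ y, hat y ψ ≤ hat y ψ' := fun y => by
    simpa using hat_lip y ψ ψ' 0 le_rfl (fun x => by simp [ψ']; linarith)
  have h4 : Continuous fun y : {μ : C(X, ℝ) → ℝ // IsIf μ} => exp (y.1 φ) := by
    have : Continuous fun y : {μ : C(X, ℝ) → ℝ // IsIf μ} => y.1 φ :=
      (continuous_apply φ).comp continuous_subtype_val
    exact continuous_exp.comp this
  have h5 := Metric.continuousAt_iff'.1 (h4.continuousAt (x := y0)) (ε / 4) (by linarith)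
  filter_upwards [h5] with y hy
  rw [Real.dist_eq, abs_lt] at hy ⊢
  rw [← h1, ← h1] at hy
  have := h2 y; have := h3 y; have := h2 y0; have := h3 y0
  constructor <;> linarith

def hSet : Set (ℕ → ℝ) := {h | h 0 = 1 ∧ (∀ i, 0 ≤ h i) ∧ (∀ i, h i ≤ 1) ∧
  ∀ i j, h (j + 1) = 0 ∨ h (i + 1) ≤ 1 / ((j : ℝ) + 3)}

theorem hSet_compact : IsCompact hSet := by
  have hc : IsCompact (Set.pi univ fun _ : ℕ => Icc (0:ℝ) 1) :=
    isCompact_univ_pi fun _ => isCompact_Icc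
  refine hc.of_isClosed_subset ?_ ?_
  · have : hSet = {h | h 0 = 1} ∩ (⋂ i, {h | 0 ≤ h i}) ∩ (⋂ i, {h | h i ≤ 1}) ∩
        ⋂ i, ⋂ j, ({h : ℕ → ℝ | h (j + 1) = 0} ∪ {h | h (i + 1) ≤ 1 / ((j : ℝ) + 3)}) := by
      ext h
      simp [hSet, and_assoc]
    rw [this]
    refine IsClosed.inter (IsClosed.inter (IsClosed.inter ?_ ?_) ?_) ?_
    · exact isClosed_eq (continuous_apply 0) continuous_const
    · exact isClosed_iInter fun i => isClosed_le continuous_const (continuous_apply i)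
    · exact isClosed_iInter fun i => isClosed_le (continuous_apply i) continuous_const
    · exact isClosed_iInter fun i => isClosed_iInter fun j =>
        (isClosed_eq (continuous_apply _) continuous_const).union
          (isClosed_le (continuous_apply _) continuous_const)
  · intro h hh i _
    exact ⟨hh.2.1 i, hh.2.2.1 i⟩

noncomputable def seqF {X : Type*} [TopologicalSpace X] (p : (ℕ → X) × (ℕ → ℝ)) :
    C(X, ℝ) → ℝ := fun φ => log (⨆ i, p.2 i * exp (φ (p.1 i)))

theorem seqF_pos {X : Type*} [TopologicalSpace X] [CompactSpace X]
    (p : (ℕ → X) × (ℕ → ℝ)) (hp : p.2 ∈ hSet) (φ : C(X, ℝ)) :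
    0 < ⨆ i, p.2 i * exp (φ (p.1 i)) := by
  have := le_ciSup (crit_bdd p.2 p.1 hp.2.1 hp.2.2.1 φ) 0
  refine lt_of_lt_of_le ?_ this
  rw [hp.1, one_mul]
  exact exp_pos _

theorem seqF_isIf {X : Type*} [TopologicalSpace X] [CompactSpace X]
    (p : (ℕ → X) × (ℕ → ℝ)) (hp : p.2 ∈ hSet) : IsIf (seqF p) := by
  classical
  have hN : ∃ N, 0 < p.2 N ∧ ∀ j, 0 < p.2 j → j ≤ N := by
    have hb : BddAbove {j | 0 < p.2 j} := by
      by_cases h : ∃ i, 0 < p.2 (i + 1)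
      · obtain ⟨i, hi⟩ := h
        refine ⟨⌈1 / p.2 (i + 1)⌉₊, ?_⟩
        intro j hj
        rcases j with _ | j
        · simp
        · have hj' : 0 < p.2 (j + 1) := hj
          have h2 := (hp.2.2.2 i j).resolve_left hj'.ne'
          have h3 : ((j + 1 : ℕ) : ℝ) ≤ 1 / p.2 (i + 1) := by
            rw [le_div_iff₀ hi]
            rw [le_div_iff₀ (by positivity)] at h2
            push_cast
            nlinarith
          exact_mod_cast h3.trans (Nat.le_ceil _)
      · push Not at h
        refine ⟨0, ?_⟩
        intro j hj
        rcases j with _ | j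
        · simp
        · exact absurd hj (not_lt.2 (h j))
    have hne : {j | 0 < p.2 j}.Nonempty := ⟨0, by simp [hp.1]⟩
    exact ⟨sSup {j | 0 < p.2 j}, Nat.sSup_mem hne hb, fun j hj => le_csSup hb hj⟩
  obtain ⟨N, hN0, hN⟩ := hN
  refine crit p.2 p.1 (fun j => (⟨min j N, by omega⟩ : Fin (N + 1))) 0 0 ?_ hp.1 hp.2.1 hp.2.2.1
    ?_ ?_ (seqF p) ?_
  · ext; simp
  · intro w w' hw hw' h
    have h1 := hN w hw
    have h2 := hN w' hw'
    simp only [Fin.mk.injEq] at h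
    have : w = w' := by omega
    rw [this]
  · intro w hw h
    have h1 := hN w hw
    have h2 : w ≠ 0 := by
      rintro rfl
      apply h
      ext; simp
    obtain ⟨i, rfl⟩ := Nat.exists_eq_succ_of_ne_zero h2
    obtain ⟨j, rfl⟩ := Nat.exists_eq_succ_of_ne_zero (show N ≠ 0 by omega)
    have h3 := (hp.2.2.2 i j).resolve_left hN0.ne'
    simp only [Fintype.card_fin]
    refine h3.trans (le_of_eq ?_)
    push_cast
    ring
  · intro φ
    exact exp_log (seqF_pos p hp φ)

theorem seqF_surj {X : Type*} [TopologicalSpace X] [CompactSpace X] (μ : C(X, ℝ) → ℝ)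
    (hμ : IsIf μ) : ∃ p : (ℕ → X) × (ℕ → ℝ), p.2 ∈ hSet ∧ seqF p = μ := by
  obtain ⟨R⟩ := exists_rep hμ
  have hn : 0 < R.n := lt_of_le_of_lt (Nat.zero_le _) R.i0.2
  let σ := Equiv.swap (⟨0, hn⟩ : Fin R.n) R.i0
  let x' : ℕ → X := fun j => if h : j < R.n then R.x (σ ⟨j, h⟩) else R.x R.i0
  let h' : ℕ → ℝ := fun j => if h : j < R.n then R.h (σ ⟨j, h⟩) else 0
  have hmem : h' ∈ hSet := by
    refine ⟨?_, ?_, ?_, ?_⟩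
    · simp only [h', dif_pos hn, σ, Equiv.swap_apply_left, R.main]
    · intro i
      simp only [h']
      split_ifs
      · exact (R.pos _).le
      · exact le_rfl
    · intro i
      simp only [h']
      split_ifs
      · exact R.le_one _
      · norm_num
    · intro i j
      by_cases hj : j + 1 < R.n
      · right
        simp only [h']
        split_ifs with hi
        · refine (R.small _ ?_).trans ?_
          · intro h
            have : (⟨i + 1, hi⟩ : Fin R.n) = ⟨0, hn⟩ := by
              apply σ.injective
              rw [h]
              simp [σ]
            simp at this
          · have : ((j + 1 + 1 : ℕ) : ℝ) ≤ R.n := by exact_mod_cast hj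
            push_cast at this
            apply one_div_le_one_div_of_le
            · positivity
            · linarith
        · positivity
      · left
        simp only [h', dif_neg hj]
  refine ⟨(x', h'), hmem, ?_⟩
  funext φ
  have hpos := seqF_pos (x', h') hmem φ
  apply exp_injective
  change exp (log _) = _
  rw [exp_log hpos]
  apply le_antisymm
  · apply ciSup_le
    intro j
    simp only [h', x']
    split_ifs
    · exact R.le φ _
    · rw [zero_mul]; exact (exp_pos _).le
  · obtain ⟨i, hi⟩ := R.ex φ
    have := le_ciSup (crit_bdd h' x' hmem.2.1 hmem.2.2.1 φ) (σ.symm i).1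
    refine le_trans (le_of_eq ?_) this
    simp only [h', x', dif_pos (σ.symm i).2, Fin.eta, Equiv.apply_symm_apply]
    exact hi

theorem seqF_cont {X : Type*} [TopologicalSpace X] [CompactSpace X] (φ : C(X, ℝ)) :
    ContinuousOn (fun p : (ℕ → X) × (ℕ → ℝ) => seqF p φ) {p | p.2 ∈ hSet} := by
  unfold seqF
  refine ContinuousOn.log ?_ (fun p hp => (seqF_pos p hp φ).ne')
  let f : ℕ → (ℕ → X) × (ℕ → ℝ) → ℝ := fun N p =>
    (Finset.range (N + 1)).sup' ⟨0, by simp⟩ fun i => p.2 i * exp (φ (p.1 i))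
  have hf : ∀ N, Continuous (f N) := by
    intro N
    apply Continuous.finset_sup'_apply
    intro i _
    have h1 : Continuous fun p : (ℕ → X) × (ℕ → ℝ) => p.2 i :=
      (continuous_apply i).comp continuous_snd
    have h2 : Continuous fun p : (ℕ → X) × (ℕ → ℝ) => φ (p.1 i) :=
      φ.continuous.comp ((continuous_apply i).comp continuous_fst)
    exact h1.mul (continuous_exp.comp h2)
  have hu : TendstoUniformlyOn f (fun p => ⨆ i, p.2 i * exp (φ (p.1 i))) Filter.atTop
      {p | p.2 ∈ hSet} := by
    rw [Metric.tendstoUniformlyOn_iff]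
    intro ε hε
    have ht : Filter.Tendsto (fun N : ℕ => exp ‖φ‖ / ((N : ℝ) + 1)) Filter.atTop (𝓝 0) := by
      have := (tendsto_one_div_add_atTop_nhds_zero_nat (𝕜 := ℝ)).const_mul (exp ‖φ‖)
      simpa [div_eq_mul_inv] using this
    filter_upwards [(ht.eventually (gt_mem_nhds hε))] with N hN p hp
    have hp' : p.2 ∈ hSet := hp
    have hb := crit_bdd p.2 p.1 hp'.2.1 hp'.2.2.1 φ
    have h1 : f N p ≤ ⨆ i, p.2 i * exp (φ (p.1 i)) := by
      apply Finset.sup'_le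
      intro i _
      exact le_ciSup hb i
    have h0 : 0 ≤ f N p := by
      refine le_trans ?_ (Finset.le_sup' (s := Finset.range (N + 1))
        (fun i => p.2 i * exp (φ (p.1 i))) (b := 0) (by simp))
      rw [hp'.1, one_mul]
      exact (exp_pos _).le
    have h2 : ⨆ i, p.2 i * exp (φ (p.1 i)) ≤ f N p + exp ‖φ‖ / ((N : ℝ) + 1) := by
      apply ciSup_le
      intro i
      by_cases hi : i < N + 1
      · have := Finset.le_sup' (s := Finset.range (N + 1))
          (fun i => p.2 i * exp (φ (p.1 i))) (b := i) (by simpa using hi)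
        have h3 : 0 ≤ exp ‖φ‖ / ((N : ℝ) + 1) := by positivity
        exact this.trans (by simpa [f] using h3)
      · obtain ⟨j, rfl⟩ := Nat.exists_eq_succ_of_ne_zero (show i ≠ 0 by omega)
        have h3 : p.2 (j + 1) ≤ 1 / ((N : ℝ) + 1) := by
          rcases hp'.2.2.2 j j with h | h
          · rw [h]; positivity
          · refine h.trans ?_
            apply one_div_le_one_div_of_le (by positivity)
            have : N ≤ j := by omega
            have : (N : ℝ) ≤ j := by exact_mod_cast this
            linarith
        have h4 := exp_le_exp.2 ((le_abs_self _).trans (φ.norm_coe_le_norm (p.1 (j + 1))))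
        have h5 : p.2 (j + 1) * exp (φ (p.1 (j + 1))) ≤ 1 / ((N : ℝ) + 1) * exp ‖φ‖ := by
          gcongr
        have h6 : 1 / ((N : ℝ) + 1) * exp ‖φ‖ = exp ‖φ‖ / ((N : ℝ) + 1) := by ring
        simp only [Nat.succ_eq_add_one]
        linarith
    rw [Real.dist_eq, abs_of_nonneg (by linarith)]
    linarith
  exact hu.continuousOn (Filter.Eventually.frequently
    (Filter.Eventually.of_forall fun N => (hf N).continuousOn))

theorem compact_If (X : Type*) [TopologicalSpace X] [CompactSpace X] :
    CompactSpace {μ : C(X, ℝ) → ℝ // IsIf μ} := by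
  have h1 : IsCompact ({p | p.2 ∈ hSet} : Set ((ℕ → X) × (ℕ → ℝ))) := by
    have := (isCompact_univ (X := ℕ → X)).prod hSet_compact
    convert this using 1
    ext p; simp
  have h2 : IsCompact (seqF '' ({p | p.2 ∈ hSet} : Set ((ℕ → X) × (ℕ → ℝ)))) :=
    h1.image_of_continuousOn (continuousOn_pi.2 fun φ => seqF_cont φ)
  have h3 : seqF '' ({p | p.2 ∈ hSet} : Set ((ℕ → X) × (ℕ → ℝ))) = {μ | IsIf μ} := by
    ext μ
    constructor
    · rintro ⟨p, hp, rfl⟩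
      exact seqF_isIf p hp
    · intro hμ
      obtain ⟨p, hp, rfl⟩ := seqF_surj μ hμ
      exact ⟨p, hp, rfl⟩
  rw [h3] at h2
  exact isCompact_iff_compactSpace.1 h2

theorem If_lip {X : Type*} [TopologicalSpace X] {μ : C(X, ℝ) → ℝ} (hμ : IsIf μ)
    (φ φ' : C(X, ℝ)) (c : ℝ) (h : ∀ x, φ x ≤ φ' x + c) : μ φ ≤ μ φ' + c := by
  obtain ⟨R⟩ := exists_rep hμ
  obtain ⟨i, hi⟩ := R.ex φ
  have h1 := R.le φ' i
  rw [← exp_le_exp, hi, exp_add]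
  have h2 : exp (φ (R.x i)) ≤ exp (φ' (R.x i)) * exp c := by
    rw [← exp_add]; exact exp_le_exp.2 (h _)
  have h3 := R.pos i
  calc R.h i * exp (φ (R.x i)) ≤ R.h i * (exp (φ' (R.x i)) * exp c) := by gcongr
    _ = (R.h i * exp (φ' (R.x i))) * exp c := by ring
    _ ≤ _ := by gcongr

theorem metrizable_If (X : Type*) [TopologicalSpace X] [CompactSpace X]
    [TopologicalSpace.MetrizableSpace X] :
    TopologicalSpace.MetrizableSpace {μ : C(X, ℝ) → ℝ // IsIf μ} := by
  let _ := TopologicalSpace.metrizableSpaceMetric X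
  have := compact_If X
  let s := TopologicalSpace.denseSeq C(X, ℝ)
  let F : {μ : C(X, ℝ) → ℝ // IsIf μ} → (ℕ → ℝ) := fun y k => y.1 (s k)
  have hF : Continuous F := continuous_pi fun k =>
    (continuous_apply (s k)).comp continuous_subtype_val
  have hi : Function.Injective F := by
    intro y y' h
    apply Subtype.ext
    funext φ
    apply eq_of_forall_dist_le
    intro ε hε
    obtain ⟨k, hk⟩ := (TopologicalSpace.denseRange_denseSeq C(X, ℝ)).exists_dist_lt φ
      (show 0 < ε / 2 by linarith)
    have hk2 : y.1 (s k) = y'.1 (s k) := congrFun h k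
    have h1 : ∀ x, φ x ≤ s k x + ε / 2 := fun x => by
      have := (ContinuousMap.dist_apply_le_dist x).trans hk.le
      rw [Real.dist_eq, abs_le] at this
      simp only [s]
      linarith
    have h2 : ∀ x, s k x ≤ φ x + ε / 2 := fun x => by
      have := (ContinuousMap.dist_apply_le_dist x).trans hk.le
      rw [Real.dist_eq, abs_le] at this
      simp only [s]
      linarith
    have := If_lip y.2 _ _ _ h1
    have := If_lip y.2 _ _ _ h2
    have := If_lip y'.2 _ _ _ h1
    have := If_lip y'.2 _ _ _ h2
    rw [Real.dist_eq, abs_le]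
    constructor <;> linarith
  exact (hF.isClosedEmbedding hi).isEmbedding.metrizableSpace

def lk {X : Type*} [MetricSpace X] (D : X → ℝ) (a : ℝ) (x y : X) : Prop :=
  D x ≤ a ∧ D y ≤ a ∧ dist x y ≤ a

noncomputable def cc {X : Type*} [MetricSpace X] (D : X → ℝ) (x y : X) : ℝ :=
  sInf {a | Relation.TransGen (lk D a) x y}

theorem lk_mono {X : Type*} [MetricSpace X] {D : X → ℝ} {a b : ℝ} (h : a ≤ b) {x y : X}
    (hl : Relation.TransGen (lk D a) x y) : Relation.TransGen (lk D b) x y :=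
  Relation.TransGen.mono (fun _ _ hh => ⟨hh.1.trans h, hh.2.1.trans h, hh.2.2.trans h⟩) _ _ hl

theorem lk_nonneg {X : Type*} [MetricSpace X] {D : X → ℝ} {a : ℝ} {x y : X}
    (hl : Relation.TransGen (lk D a) x y) : 0 ≤ a := by
  induction hl with
  | single h => exact dist_nonneg.trans h.2.2
  | tail _ h _ => exact dist_nonneg.trans h.2.2

theorem cc_bdd {X : Type*} [MetricSpace X] (D : X → ℝ) (x y : X) :
    BddBelow {a | Relation.TransGen (lk D a) x y} := ⟨0, fun _ h => lk_nonneg h⟩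

theorem cc_nonempty {X : Type*} [MetricSpace X] (D : X → ℝ) (x y : X) :
    {a | Relation.TransGen (lk D a) x y}.Nonempty :=
  ⟨max (D x) (max (D y) (dist x y)), Relation.TransGen.single
    ⟨le_max_left _ _, (le_max_left _ _).trans (le_max_right _ _),
      (le_max_right _ _).trans (le_max_right _ _)⟩⟩

theorem cc_le {X : Type*} [MetricSpace X] {D : X → ℝ} {a : ℝ} {x y : X}
    (hl : Relation.TransGen (lk D a) x y) : cc D x y ≤ a := csInf_le (cc_bdd D x y) hl

theorem cc_lt {X : Type*} [MetricSpace X] {D : X → ℝ} {a : ℝ} {x y : X}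
    (h : cc D x y < a) : ∃ b < a, Relation.TransGen (lk D b) x y := by
  obtain ⟨b, hb, hba⟩ := exists_lt_of_csInf_lt (cc_nonempty D x y) h
  exact ⟨b, hba, hb⟩

theorem cc_symm {X : Type*} [MetricSpace X] (D : X → ℝ) (x y : X) : cc D x y = cc D y x := by
  have hs : ∀ a x y, Relation.TransGen (lk D a) x y → Relation.TransGen (lk D a) y x := by
    intro a x y h
    have : Std.Symm (lk D a) := ⟨fun x y h => ⟨h.2.1, h.1, by rw [dist_comm]; exact h.2.2⟩⟩
    exact Std.Symm.symm _ _ h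
  unfold cc
  congr 1
  ext a
  exact ⟨hs a x y, hs a y x⟩

theorem cc_ultra {X : Type*} [MetricSpace X] (D : X → ℝ) (x y w : X) :
    cc D x w ≤ max (cc D x y) (cc D y w) := by
  apply le_of_forall_gt_imp_ge_of_dense
  intro a ha
  obtain ⟨h1, h2⟩ := max_lt_iff.1 ha
  obtain ⟨b, hb, hb'⟩ := cc_lt h1
  obtain ⟨c, hc, hc'⟩ := cc_lt h2
  exact cc_le ((lk_mono hb.le hb').trans (lk_mono hc.le hc'))

theorem lk_left {X : Type*} [MetricSpace X] {D : X → ℝ} {a : ℝ} {x y : X}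
    (hl : Relation.TransGen (lk D a) x y) : D x ≤ a ∧ D y ≤ a := by
  induction hl with
  | single h => exact ⟨h.1, h.2.1⟩
  | tail _ h ih => exact ⟨ih.1, h.2.1⟩

theorem cc_perturb {X : Type*} [MetricSpace X] {D D' : X → ℝ} {x y x' y' : X} {ε : ℝ}
    (hD : ∀ w, D' w ≤ D w + ε) (hx : dist x x' ≤ ε) (hy : dist y y' ≤ ε)
    (hDx : D' x' ≤ D x + ε) (hDy : D' y' ≤ D y + ε) : cc D' x' y' ≤ cc D x y + ε := by
  have hε : 0 ≤ ε := dist_nonneg.trans hx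
  rw [← sub_le_iff_le_add]
  apply le_csInf (cc_nonempty D x y)
  intro a ha
  have ha' : Relation.TransGen (lk D a) x y := ha
  rw [sub_le_iff_le_add]
  apply cc_le
  have h0 := lk_nonneg ha'
  obtain ⟨h1, h2⟩ := lk_left ha'
  have h3 : Relation.TransGen (lk D' (a + ε)) x y := by
    refine Relation.TransGen.mono (fun u v h => ?_) _ _ ha'
    exact ⟨(hD u).trans (by linarith [h.1]), (hD v).trans (by linarith [h.2.1]),
      by linarith [h.2.2]⟩
  refine Relation.TransGen.trans (Relation.TransGen.single ?_)
    (h3.trans (Relation.TransGen.single ?_))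
  · exact ⟨by linarith, by linarith [hD x], by rw [dist_comm]; linarith⟩
  · exact ⟨by linarith [hD y], by linarith, by linarith⟩

theorem cc_cont {X T : Type*} [MetricSpace X] [CompactSpace X] [TopologicalSpace T]
    (D : T → X → ℝ) (hD : Continuous fun p : T × X => D p.1 p.2) :
    Continuous fun p : T × X × X => cc (D p.1) p.2.1 p.2.2 := by
  let DD : T → C(X, ℝ) := fun t => ⟨D t, by fun_prop⟩
  have hDD : Continuous DD := ContinuousMap.continuous_of_continuous_uncurry _ hD
  rw [continuous_iff_continuousAt]
  rintro ⟨t0, x0, y0⟩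
  rw [Metric.continuousAt_iff']
  intro ε hε
  have e1 : ∀ᶠ p : T × X × X in 𝓝 (t0, x0, y0), dist (DD p.1) (DD t0) < ε / 2 / 2 := by
    have : Continuous fun p : T × X × X => DD p.1 := hDD.comp continuous_fst
    exact Metric.continuousAt_iff'.1 (this.continuousAt (x := (t0, x0, y0))) _ (by linarith)
  have e2 : ∀ᶠ p : T × X × X in 𝓝 (t0, x0, y0), dist p.2.1 x0 < ε / 2 := by
    have : Continuous fun p : T × X × X => p.2.1 := by fun_prop
    exact Metric.continuousAt_iff'.1 (this.continuousAt (x := (t0, x0, y0))) _ (by linarith)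
  have e3 : ∀ᶠ p : T × X × X in 𝓝 (t0, x0, y0), dist p.2.2 y0 < ε / 2 := by
    have : Continuous fun p : T × X × X => p.2.2 := by fun_prop
    exact Metric.continuousAt_iff'.1 (this.continuousAt (x := (t0, x0, y0))) _ (by linarith)
  have e4 : ∀ᶠ p : T × X × X in 𝓝 (t0, x0, y0), dist (D t0 p.2.1) (D t0 x0) < ε / 2 / 2 := by
    have : Continuous fun p : T × X × X => D t0 p.2.1 := by fun_prop
    exact Metric.continuousAt_iff'.1 (this.continuousAt (x := (t0, x0, y0))) _ (by linarith)
  have e5 : ∀ᶠ p : T × X × X in 𝓝 (t0, x0, y0), dist (D t0 p.2.2) (D t0 y0) < ε / 2 / 2 := by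
    have : Continuous fun p : T × X × X => D t0 p.2.2 := by fun_prop
    exact Metric.continuousAt_iff'.1 (this.continuousAt (x := (t0, x0, y0))) _ (by linarith)
  filter_upwards [e1, e2, e3, e4, e5] with p h1 h2 h3 h4 h5
  have h6 : ∀ w, |D p.1 w - D t0 w| < ε / 2 / 2 := fun w => by
    have := (ContinuousMap.dist_apply_le_dist (f := DD p.1) (g := DD t0) w).trans_lt h1
    rwa [Real.dist_eq] at this
  rw [Real.dist_eq] at h4 h5
  have hA : cc (D p.1) p.2.1 p.2.2 ≤ cc (D t0) x0 y0 + ε / 2 := by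
    apply cc_perturb
    · intro w; linarith [(abs_lt.1 (h6 w)).2]
    · rw [dist_comm]; exact h2.le
    · rw [dist_comm]; exact h3.le
    · linarith [(abs_lt.1 (h6 p.2.1)).2, (abs_lt.1 h4).2]
    · linarith [(abs_lt.1 (h6 p.2.2)).2, (abs_lt.1 h5).2]
  have hB : cc (D t0) x0 y0 ≤ cc (D p.1) p.2.1 p.2.2 + ε / 2 := by
    apply cc_perturb
    · intro w; linarith [(abs_lt.1 (h6 w)).1]
    · exact h2.le
    · exact h3.le
    · linarith [(abs_lt.1 (h6 p.2.1)).1, (abs_lt.1 h4).1]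
    · linarith [(abs_lt.1 (h6 p.2.2)).1, (abs_lt.1 h5).1]
  rw [Real.dist_eq, abs_lt]
  constructor <;> linarith

theorem lk_diam {X ι : Type*} [MetricSpace X] [Fintype ι] {D : X → ℝ} {a ρ : ℝ} {x y : X}
    (p : ι → X) (hρ : 0 ≤ ρ) (hp : ∀ v, D v ≤ a → ∃ i, dist v (p i) ≤ ρ)
    (hl : Relation.TransGen (lk D a) x y) :
    dist x y ≤ ((Fintype.card ι : ℝ) + 1) * (2 * ρ + a) := by
  classical
  have h0 := lk_nonneg hl
  let G : SimpleGraph ι := SimpleGraph.fromRel fun i j => dist (p i) (p j) ≤ 2 * ρ + a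
  have hadj : ∀ i j, dist (p i) (p j) ≤ 2 * ρ + a → G.Reachable i j := by
    intro i j h
    by_cases hij : i = j
    · rw [hij]
    · apply SimpleGraph.Adj.reachable
      simp only [G, SimpleGraph.fromRel_adj]
      exact ⟨hij, Or.inl h⟩
  have hadj' : ∀ i j, G.Adj i j → dist (p i) (p j) ≤ 2 * ρ + a := by
    intro i j h
    simp only [G, SimpleGraph.fromRel_adj] at h
    rcases h.2 with h | h
    · exact h
    · rw [dist_comm]; exact h
  have hwalk : ∀ i j (w : G.Walk i j), dist (p i) (p j) ≤ w.length * (2 * ρ + a) := by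
    intro i j w
    induction w with
    | nil => simp
    | @cons u v w' h q ih =>
      have := hadj' _ _ h
      have := dist_triangle (p u) (p v) (p w')
      rw [SimpleGraph.Walk.length_cons]
      push_cast
      linarith
  obtain ⟨i, hi⟩ := hp x (lk_left hl).1
  have key : ∀ y, Relation.TransGen (lk D a) x y → ∀ j, dist y (p j) ≤ ρ → G.Reachable i j := by
    intro y h
    induction h with
    | @single b h =>
      intro j hj
      apply hadj
      have h1 := dist_triangle4 (p i) x b (p j)
      have h2 := h.2.2
      rw [dist_comm (p i) x] at h1
      linarith
    | @tail b c hb h ih =>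
      intro j hj
      obtain ⟨k, hk⟩ := hp b h.1
      refine (ih k hk).trans (hadj _ _ ?_)
      have h1 := dist_triangle4 (p k) b c (p j)
      have h2 := h.2.2
      rw [dist_comm (p k) b] at h1
      linarith
  obtain ⟨j, hj⟩ := hp y (lk_left hl).2
  obtain ⟨w, hw⟩ := (key y hl j hj).exists_isPath
  have h1 := hwalk i j w
  have h2 : (w.length : ℝ) ≤ Fintype.card ι := by exact_mod_cast hw.length_lt.le
  have h3 := dist_triangle4 x (p i) (p j) y
  rw [dist_comm (p j) y] at h3
  nlinarith

noncomputable def psi (s t : ℝ) : ℝ := min 1 (max 0 ((t - s) / s))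

noncomputable def gk {X : Type*} [MetricSpace X] (e : X → ℝ) (D : X → ℝ) (s : ℝ) (x : X) : ℝ :=
  min (e x) (⨅ w, (e w + psi s (cc D x w)))

theorem psi_nonneg (s t : ℝ) : 0 ≤ psi s t := le_min zero_le_one (le_max_left _ _)

theorem psi_zero {s t : ℝ} (hs : 0 < s) (h : t ≤ s) : psi s t = 0 := by
  unfold psi
  rw [max_eq_left, min_eq_right zero_le_one]
  exact div_nonpos_of_nonpos_of_nonneg (by linarith) hs.le

theorem psi_one {s t : ℝ} (hs : 0 < s) (h : 2 * s ≤ t) : psi s t = 1 := by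
  unfold psi
  apply min_eq_left
  apply le_max_of_le_right
  rw [le_div_iff₀ hs]
  linarith

theorem psi_mono {s t t' : ℝ} (hs : 0 < s) (h : t ≤ t') : psi s t ≤ psi s t' := by
  unfold psi
  gcongr

theorem gk_bdd {X : Type*} [MetricSpace X] (e : X → ℝ) (he : ∀ x, 0 ≤ e x) (D : X → ℝ) (s : ℝ)
    (x : X) : BddBelow (range fun w => e w + psi s (cc D x w)) := by
  refine ⟨0, ?_⟩
  rintro _ ⟨w, rfl⟩
  exact add_nonneg (he w) (psi_nonneg _ _)

theorem gk_mem {X : Type*} [MetricSpace X] (e : X → ℝ) (he : ∀ x, e x ∈ Icc (0:ℝ) 1)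
    (D : X → ℝ) (s : ℝ) (x : X) : gk e D s x ∈ Icc (0:ℝ) 1 := by
  have : Nonempty X := ⟨x⟩
  refine ⟨le_min (he x).1 (le_ciInf fun w => add_nonneg (he w).1 (psi_nonneg _ _)),
    (min_le_left _ _).trans (he x).2⟩

theorem gk_eq_aux {X : Type*} [MetricSpace X] (e : X → ℝ) (he : ∀ x, e x ∈ Icc (0:ℝ) 1)
    (D : X → ℝ) (s : ℝ) (hs : 0 < s) (x x' : X) (hx' : D x' ≤ s)
    (h : cc D x x' ≤ s) : gk e D s x ≤ gk e D s x' := by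
  have : Nonempty X := ⟨x⟩
  have key : ⨅ w, (e w + psi s (cc D x w)) ≤ ⨅ w, (e w + psi s (cc D x' w)) := by
    apply ciInf_mono (gk_bdd e (fun x => (he x).1) D s x)
    intro w
    gcongr
    have h1 := cc_ultra D x x' w
    rcases le_total (cc D x' w) s with h2 | h2
    · rw [psi_zero hs (h1.trans (max_le h h2))]
      exact psi_nonneg _ _
    · apply psi_mono hs
      exact h1.trans (max_le (h.trans h2) le_rfl)
  unfold gk
  refine (min_le_right _ _).trans (le_min ?_ key)
  refine key.trans ((ciInf_le (gk_bdd e (fun x => (he x).1) D s x') x').trans ?_)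
  rw [psi_zero hs, add_zero]
  apply cc_le
  exact Relation.TransGen.single ⟨hx', hx', by rw [dist_self]; exact hs.le⟩

theorem gk_eq {X : Type*} [MetricSpace X] (e : X → ℝ) (he : ∀ x, e x ∈ Icc (0:ℝ) 1)
    (D : X → ℝ) (s : ℝ) (hs : 0 < s) (x x' : X) (hx : D x ≤ s) (hx' : D x' ≤ s)
    (h : dist x x' ≤ s) : gk e D s x = gk e D s x' := by
  have h1 : cc D x x' ≤ s := cc_le (Relation.TransGen.single ⟨hx, hx', h⟩)
  apply le_antisymm
  · exact gk_eq_aux e he D s hs x x' hx' h1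
  · exact gk_eq_aux e he D s hs x' x hx (by rw [cc_symm]; exact h1)

theorem gk_near {X : Type*} [MetricSpace X] (e : X → ℝ) (he : ∀ x, e x ∈ Icc (0:ℝ) 1)
    (D : X → ℝ) (s : ℝ) (hs : 0 < s) (x : X) (η : ℝ) (hη : 0 ≤ η)
    (h : ∀ w, cc D x w < 2 * s → e x ≤ e w + η) : e x - η ≤ gk e D s x ∧ gk e D s x ≤ e x := by
  have : Nonempty X := ⟨x⟩
  refine ⟨le_min (by linarith) (le_ciInf fun w => ?_), min_le_left _ _⟩
  by_cases hw : cc D x w < 2 * s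
  · have := h w hw
    have := psi_nonneg s (cc D x w)
    linarith
  · rw [psi_one hs (not_lt.1 hw)]
    have := (he x).2
    have := (he w).1
    linarith

theorem gk_cont {X T : Type*} [MetricSpace X] [CompactSpace X] [TopologicalSpace T]
    (e : X → ℝ) (he : Continuous e)
    (D : T → X → ℝ) (hD : Continuous fun p : T × X => D p.1 p.2) (s : T → ℝ) (hs : Continuous s)
    (hs0 : ∀ t, 0 < s t) : Continuous fun p : T × X => gk e (D p.1) (s p.1) p.2 := by
  unfold gk
  refine Continuous.min (by fun_prop) ?_
  have h1 : Continuous fun q : (T × X) × X => e q.2 + psi (s q.1.1) (cc (D q.1.1) q.1.2 q.2) := by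
    have hc : Continuous fun q : (T × X) × X => cc (D q.1.1) q.1.2 q.2 :=
      (cc_cont D hD).comp (show Continuous fun q : (T × X) × X => (q.1.1, q.1.2, q.2) by fun_prop)
    have hs' : Continuous fun q : (T × X) × X => s q.1.1 := by fun_prop
    unfold psi
    refine Continuous.add (by fun_prop) (continuous_const.min (continuous_const.max ?_))
    exact (hc.sub hs').div hs' (fun q => (hs0 _).ne')
  have h2 := IsCompact.continuous_sInf
    (f := fun (p : T × X) (w : X) => e w + psi (s p.1) (cc (D p.1) p.2 w))
    (isCompact_univ (X := X)) h1
  simpa only [image_univ, sInf_range] using h2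

structure Approx {X : Type*} [MetricSpace X] {μ : C(X, ℝ) → ℝ} (R : IfRep μ) (τ : ℝ)
    (N : X → ℝ) : Prop where
  pos : 0 < τ
  lt : τ < 1 / 100
  ha : ∀ w, ∃ i, N w ≤ R.h i + τ / 2 ∧ (τ / 2 < N w → dist w (R.x i) ≤ τ ^ 2)
  hb : ∀ i, R.h i - τ / 2 ≤ N (R.x i)

noncomputable def DD (τ : ℝ) (N : ℝ) : ℝ := 8 * τ ^ 2 * max 0 (2 - N / τ)

noncomputable def kap (τ : ℝ) (N : ℝ) : ℝ := min 1 (max 0 (max (N - 3 * τ) (12 * (N - 2 / 5))))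

theorem kap_nonneg (τ N : ℝ) : 0 ≤ kap τ N := le_min zero_le_one (le_max_left _ _)

theorem kap_le_one (τ N : ℝ) : kap τ N ≤ 1 := min_le_left _ _

theorem kap_pos {τ N : ℝ} (ht : τ < 1 / 100) (h : 0 < kap τ N) : 3 * τ < N := by
  by_contra hN
  have h1 : max (N - 3 * τ) (12 * (N - 2 / 5)) ≤ 0 := max_le (by linarith) (by linarith)
  unfold kap at h
  rw [max_eq_left h1, min_eq_right zero_le_one] at h
  exact lt_irrefl _ h

theorem DD_zero {τ N : ℝ} (h0 : 0 < τ) (h : 3 * τ < N) : DD τ N = 0 := by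
  unfold DD
  rw [max_eq_left, mul_zero]
  rw [sub_nonpos, le_div_iff₀ h0]
  linarith

theorem DD_lt {τ N : ℝ} (h0 : 0 < τ) (h : DD τ N < 8 * τ ^ 2) : τ < N := by
  unfold DD at h
  have h2 : max 0 (2 - N / τ) < 1 := by
    by_contra h3
    rw [not_lt] at h3
    have : 0 < 8 * τ ^ 2 := by positivity
    nlinarith
  have h4 := (le_max_right _ _).trans_lt h2
  have h5 : 1 < N / τ := by linarith
  rwa [lt_div_iff₀ h0, one_mul] at h5

theorem approx_near {X : Type*} [MetricSpace X] {μ : C(X, ℝ) → ℝ} {R : IfRep μ} {τ : ℝ}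
    {N : X → ℝ} (H : Approx R τ N) (x w : X)
    (h : cc (fun v => DD τ (N v)) x w < 2 * (4 * τ ^ 2)) : dist x w ≤ 20 * τ := by
  obtain ⟨a, ha, hl⟩ := cc_lt h
  have ht := H.pos
  have ht' := H.lt
  have hv : ∀ v, DD τ (N v) ≤ a → ∃ i, τ / 2 < R.h i ∧ dist v (R.x i) ≤ τ ^ 2 := by
    intro v hv
    have h1 : τ < N v := DD_lt ht (by linarith)
    obtain ⟨i, hi, hi'⟩ := H.ha v
    exact ⟨i, by linarith, hi' (by linarith)⟩
  by_cases hc : ∃ i, i ≠ R.i0 ∧ τ / 2 < R.h i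
  · obtain ⟨i, hi, hi'⟩ := hc
    have h1 := hi'.trans_le (R.small i hi)
    rw [lt_div_iff₀ (by positivity)] at h1
    have h2 := lk_diam R.x (by positivity : (0:ℝ) ≤ τ ^ 2)
      (fun v hv' => (hv v hv').imp fun i hi => hi.2) hl
    rw [Fintype.card_fin] at h2
    have h3 : 2 * τ ^ 2 + a ≤ 10 * τ ^ 2 := by linarith
    calc dist x w ≤ ((R.n : ℝ) + 1) * (2 * τ ^ 2 + a) := h2
      _ ≤ ((R.n : ℝ) + 1) * (10 * τ ^ 2) := by gcongr
      _ = (τ / 2 * ((R.n : ℝ) + 1)) * (20 * τ) := by ring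
      _ ≤ 1 * (20 * τ) := by gcongr
      _ = 20 * τ := one_mul _
  · push Not at hc
    have h2 := lk_diam (fun _ : Unit => R.x R.i0) (by positivity : (0:ℝ) ≤ τ ^ 2)
      (fun v hv' => ⟨(), by
        obtain ⟨i, hi, hi'⟩ := hv v hv'
        by_cases h0 : i = R.i0
        · rwa [h0] at hi'
        · linarith [hc i h0]⟩) hl
    simp only [Fintype.card_unit, Nat.cast_one] at h2
    nlinarith

theorem approx_label {X : Type*} [MetricSpace X] {μ : C(X, ℝ) → ℝ} {R : IfRep μ} {τ : ℝ}
    {N : X → ℝ} (H : Approx R τ N) : ∃ l : X → Fin R.n, (∀ w, N w ≤ R.h (l w) + τ / 2) ∧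
      (∀ w, 0 < kap τ (N w) → dist w (R.x (l w)) ≤ τ ^ 2) ∧ (∀ w, kap τ (N w) ≤ R.h (l w)) := by
  choose l hl hl' using H.ha
  have ht := H.pos
  have ht' := H.lt
  refine ⟨l, hl, fun w hw => hl' w ?_, fun w => ?_⟩
  · linarith [kap_pos ht' hw]
  · by_cases h0 : l w = R.i0
    · rw [h0, R.main]; exact kap_le_one _ _
    · have h1 := R.le_third _ h0
      have h2 := hl w
      have h3 := R.pos (l w)
      refine (min_le_right _ _).trans (max_le h3.le (max_le ?_ ?_)) <;> linarith

theorem kap_ge {τ N h : ℝ} (h0 : 0 < τ) (h1 : h ≤ 1) (hN : h - τ / 2 ≤ N) :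
    h - 7 / 2 * τ ≤ kap τ N := by
  unfold kap
  refine le_min (by linarith) (le_max_of_le_right (le_max_of_le_left ?_))
  linarith

theorem approx_isIf {X : Type*} [MetricSpace X] [CompactSpace X] {μ : C(X, ℝ) → ℝ} {R : IfRep μ}
    {τ : ℝ} {N : X → ℝ} (H : Approx R τ N) (G : X → X)
    (hG : ∀ w w', DD τ (N w) ≤ 4 * τ ^ 2 → DD τ (N w') ≤ 4 * τ ^ 2 → dist w w' ≤ 4 * τ ^ 2 →
      G w = G w') (m : C(X, ℝ) → ℝ)
    (hm : ∀ φ : C(X, ℝ), m φ = log (⨆ w, kap τ (N w) * exp (φ (G w)))) :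
    IsIf m ∧ ∀ φ : C(X, ℝ), exp (m φ) = ⨆ w, kap τ (N w) * exp (φ (G w)) := by
  have ht := H.pos
  have ht' := H.lt
  obtain ⟨l, hl, hd, hk⟩ := approx_label H
  have hN0 : 1 - τ / 2 ≤ N (R.x R.i0) := by have := H.hb R.i0; rwa [R.main] at this
  have hκ0 : kap τ (N (R.x R.i0)) = 1 := by
    apply le_antisymm (kap_le_one _ _)
    refine le_min le_rfl (le_max_of_le_right (le_max_of_le_right ?_))
    linarith
  have he : ∀ φ : C(X, ℝ), exp (m φ) = ⨆ w, kap τ (N w) * exp (φ (G w)) := by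
    intro φ
    rw [hm, exp_log]
    have h1 := le_ciSup (crit_bdd (fun w => kap τ (N w)) G (fun w => kap_nonneg _ _)
      (fun w => kap_le_one _ _) φ) (R.x R.i0)
    refine lt_of_lt_of_le ?_ h1
    simp only [hκ0, one_mul]
    exact exp_pos _
  refine ⟨?_, he⟩
  refine crit (fun w => kap τ (N w)) G l R.i0 (R.x R.i0) ?_ hκ0 (fun w => kap_nonneg _ _)
      (fun w => kap_le_one _ _) ?_ ?_ m he
  · by_contra h0
    have h1 := R.le_third _ h0
    linarith [hl (R.x R.i0)]
  · intro w w' hw hw' hll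
    have hp : 0 ≤ 4 * τ ^ 2 := by positivity
    apply hG
    · rw [DD_zero ht (kap_pos ht' hw)]; exact hp
    · rw [DD_zero ht (kap_pos ht' hw')]; exact hp
    · have h1 := hd w hw
      have h2 := hd w' hw'
      rw [← hll] at h2
      have := dist_triangle_right w w' (R.x (l w))
      linarith
  · intro w hw h0
    rw [Fintype.card_fin]
    exact (hk w).trans (R.small _ h0)

theorem approx_est {X : Type*} [MetricSpace X] [CompactSpace X]
    (y : {μ : C(X, ℝ) → ℝ // IsIf μ}) {τ : ℝ} {N : X → ℝ} (H : Approx (theRep y) τ N) (G : X → X)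
    (φ : C(X, ℝ)) (δ1 δ2 M : ℝ) (h1 : ∀ w, |exp (φ (G w)) - exp (φ w)| ≤ δ1)
    (h2 : ∀ w w', dist w w' ≤ τ ^ 2 → |exp (φ w) - exp (φ w')| ≤ δ2) (hδ2 : 0 ≤ δ2)
    (hM : ∀ w, exp (φ w) ≤ M) :
    |(⨆ w, kap τ (N w) * exp (φ (G w))) - exp (y.1 φ)| ≤ δ1 + δ2 + 7 / 2 * τ * M := by
  have ht := H.pos
  obtain ⟨l, hl, hd, hk⟩ := approx_label H
  have hne : Nonempty X := ⟨(theRep y).x (theRep y).i0⟩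
  have hM0 : 0 ≤ M := (exp_pos _).le.trans (hM ((theRep y).x (theRep y).i0))
  have hδ1 : 0 ≤ δ1 := (abs_nonneg _).trans (h1 ((theRep y).x (theRep y).i0))
  have hτM : 0 ≤ 7 / 2 * τ * M := by positivity
  rw [abs_le]
  constructor
  · obtain ⟨i, hi⟩ := (theRep y).ex φ
    have h3 := le_ciSup (crit_bdd (fun w => kap τ (N w)) G (fun w => kap_nonneg _ _)
      (fun w => kap_le_one _ _) φ) ((theRep y).x i)
    set q := (theRep y).x i
    have h4 := kap_ge ht ((theRep y).le_one i) (H.hb i)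
    have h5 := (abs_le.1 (h1 q)).1
    have h6 := (theRep y).le_one i
    have h7 := (theRep y).pos i
    have h8 := hM (G q)
    have h9 := exp_pos (φ (G q))
    rw [hi]
    have h10 : (theRep y).h i * exp (φ q) ≤ (theRep y).h i * (exp (φ (G q)) + δ1) := by
      gcongr; linarith
    have h11 : ((theRep y).h i - 7 / 2 * τ) * exp (φ (G q)) ≤ kap τ (N q) * exp (φ (G q)) := by
      gcongr
    have h12 : 7 / 2 * τ * exp (φ (G q)) ≤ 7 / 2 * τ * M := by gcongr
    nlinarith
  · rw [sub_le_iff_le_add]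
    apply ciSup_le
    intro w
    rcases (kap_nonneg τ (N w)).eq_or_lt with h0 | h0
    · rw [← h0, zero_mul]
      have := exp_pos (y.1 φ)
      linarith
    · have h3 := (theRep y).le φ (l w)
      have h4 := (abs_le.1 (h2 _ _ (hd w h0))).2
      have h5 := (abs_le.1 (h1 w)).2
      have h6 := (theRep y).le_one (l w)
      have h7 := (theRep y).pos (l w)
      have h8 := hk w
      have h9 := exp_pos (φ (G w))
      have h10 : kap τ (N w) * exp (φ (G w)) ≤ (theRep y).h (l w) * exp (φ (G w)) := by gcongr
      have h11 : (theRep y).h (l w) * exp (φ (G w)) ≤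
        (theRep y).h (l w) * (exp (φ ((theRep y).x (l w))) + (δ1 + δ2)) := by gcongr; linarith
      nlinarith

noncomputable def tent {X : Type*} [MetricSpace X] (w : X) (ρ : ℝ) : C(X, ℝ) :=
  ⟨fun x => max 0 (ρ - dist w x), by fun_prop⟩

theorem approx_of {X : Type*} [MetricSpace X] (y : {μ : C(X, ℝ) → ℝ // IsIf μ}) {τ : ℝ}
    (h0 : 0 < τ) (h1 : τ < 1 / 100) (P : X → ℝ)
    (hP : ∀ w, |P w - hat y (tent w (τ ^ 2))| ≤ τ ^ 3 / 2) :
    Approx (theRep y) τ (fun w => P w / τ ^ 2) := by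
  have hτ : 0 < τ ^ 2 := by positivity
  refine ⟨h0, h1, fun w => ?_, fun i => ?_⟩
  · obtain ⟨i, hi⟩ := ex_hat y (tent w (τ ^ 2))
    have h2 := (abs_le.1 (hP w)).2
    have h3 := (theRep y).pos i
    have h4 : tent w (τ ^ 2) ((theRep y).x i) = max 0 (τ ^ 2 - dist w ((theRep y).x i)) := rfl
    rw [h4] at hi
    refine ⟨i, ?_, ?_⟩
    · rw [div_le_iff₀ hτ]
      have : max 0 (τ ^ 2 - dist w ((theRep y).x i)) ≤ τ ^ 2 :=
        max_le hτ.le (by linarith [dist_nonneg (x := w) (y := (theRep y).x i)])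
      nlinarith
    · intro h5
      rw [lt_div_iff₀ hτ] at h5
      by_contra h6
      rw [max_eq_left (by linarith), mul_zero] at hi
      nlinarith
  · have h2 := (abs_le.1 (hP ((theRep y).x i))).1
    have h3 := le_hat y (tent ((theRep y).x i) (τ ^ 2)) i
    have h4 : tent ((theRep y).x i) (τ ^ 2) ((theRep y).x i) =
      max 0 (τ ^ 2 - dist ((theRep y).x i) ((theRep y).x i)) := rfl
    rw [h4, dist_self, sub_zero, max_eq_right hτ.le] at h3
    rw [le_div_iff₀ hτ]
    nlinarith

theorem hat_tent_cont {X : Type*} [MetricSpace X] [CompactSpace X] :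
    Continuous fun p : {μ : C(X, ℝ) → ℝ // IsIf μ} × X × ℝ => hat p.1 (tent p.2.1 p.2.2) := by
  rw [continuous_iff_continuousAt]
  rintro ⟨y0, w0, ρ0⟩
  rw [Metric.continuousAt_iff']
  intro ε hε
  have c1 : Continuous fun p : {μ : C(X, ℝ) → ℝ // IsIf μ} × X × ℝ => hat p.1 (tent w0 ρ0) :=
    (hat_cont (tent w0 ρ0) (fun x => le_max_left _ _)).comp continuous_fst
  have c2 : Continuous fun p : {μ : C(X, ℝ) → ℝ // IsIf μ} × X × ℝ =>
    dist p.2.1 w0 + |p.2.2 - ρ0| := by fun_prop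
  have e1 := Metric.continuousAt_iff'.1 (c1.continuousAt (x := (y0, w0, ρ0))) (ε / 2) (by linarith)
  have e2 := Metric.continuousAt_iff'.1 (c2.continuousAt (x := (y0, w0, ρ0))) (ε / 2) (by linarith)
  filter_upwards [e1, e2] with p h1 h2
  simp only [dist_self, sub_self, abs_zero, add_zero] at h2
  rw [Real.dist_eq, sub_zero] at h2
  have h2' := (le_abs_self _).trans_lt h2
  rw [Real.dist_eq, abs_lt] at h1
  have hA : ∀ x, tent p.2.1 p.2.2 x ≤ tent w0 ρ0 x + (dist p.2.1 w0 + |p.2.2 - ρ0|) := by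
    intro x
    show max 0 (p.2.2 - dist p.2.1 x) ≤ max 0 (ρ0 - dist w0 x) + _
    have a1 := dist_triangle_left w0 x p.2.1
    have a1 := dist_triangle w0 p.2.1 x
    rw [dist_comm w0] at a1
    have a2 := le_abs_self (p.2.2 - ρ0)
    have a3 := dist_nonneg (x := p.2.1) (y := w0)
    have a4 := abs_nonneg (p.2.2 - ρ0)
    have a5 := le_max_left 0 (ρ0 - dist w0 x)
    have a6 := le_max_right 0 (ρ0 - dist w0 x)
    apply max_le <;> linarith
  have hB : ∀ x, tent w0 ρ0 x ≤ tent p.2.1 p.2.2 x + (dist p.2.1 w0 + |p.2.2 - ρ0|) := by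
    intro x
    show max 0 (ρ0 - dist w0 x) ≤ max 0 (p.2.2 - dist p.2.1 x) + _
    have a1 := dist_triangle p.2.1 w0 x
    have a2 := neg_abs_le (p.2.2 - ρ0)
    have a3 := dist_nonneg (x := p.2.1) (y := w0)
    have a4 := abs_nonneg (p.2.2 - ρ0)
    have a5 := le_max_left 0 (p.2.2 - dist p.2.1 x)
    have a6 := le_max_right 0 (p.2.2 - dist p.2.1 x)
    apply max_le <;> linarith
  have hc : 0 ≤ dist p.2.1 w0 + |p.2.2 - ρ0| := by positivity
  have b1 := hat_lip p.1 _ _ _ hc hA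
  have b2 := hat_lip p.1 _ _ _ hc hB
  rw [Real.dist_eq, abs_lt]
  constructor <;> linarith

theorem anr_Q (X : Type u) [MetricSpace X] [CompactSpace X] [Nonempty X] (hX : IsCompactANR X) :
    ∃ e : ℕ → X → ℝ, (∀ k x, e k x ∈ Icc (0:ℝ) 1) ∧ (∀ k x y, e k x ≤ e k y + dist x y) ∧
      ∃ V : Set (ℕ → ℝ), IsOpen V ∧ ∃ r : (ℕ → ℝ) → X, ContinuousOn r V ∧
        ∀ x, (fun k => e k x) ∈ V ∧ r (fun k => e k x) = x := by
  classical
  let d := TopologicalSpace.denseSeq X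
  let e : ℕ → X → ℝ := fun k x => min 1 (dist x (d k))
  have he : ∀ k x, e k x ∈ Icc (0:ℝ) 1 := fun k x =>
    ⟨le_min zero_le_one dist_nonneg, min_le_left _ _⟩
  have hl : ∀ k x y, e k x ≤ e k y + dist x y := by
    intro k x y
    show min 1 (dist x (d k)) ≤ min 1 (dist y (d k)) + dist x y
    rw [← min_add_add_right]
    apply min_le_min
    · linarith [dist_nonneg (x := x) (y := y)]
    · linarith [dist_triangle x y (d k)]
  have hc : ∀ k, Continuous (e k) := fun k => by fun_prop
  have hi : ∀ x y, (∀ k, e k x = e k y) → x = y := by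
    intro x y h
    by_contra hxy
    have hp : 0 < dist x y := dist_pos.2 hxy
    obtain ⟨_, hq, ⟨k, rfl⟩⟩ := Metric.dense_iff.1 (TopologicalSpace.denseRange_denseSeq X) x
      (min 1 (dist x y / 2)) (by positivity)
    rw [Metric.mem_ball, dist_comm, lt_min_iff] at hq
    have h1 := h k
    have h2 : e k x = dist x (d k) := min_eq_right hq.1.le
    have h3 : dist y (d k) = dist x (d k) := by
      have h4 : min 1 (dist y (d k)) = dist x (d k) := by rw [← h2, h1]
      rcases min_choice 1 (dist y (d k)) with h5 | h5
      · rw [h5] at h4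
        have := hq.1
        change dist x (d k) < 1 at this
        linarith
      · rw [← h5, h4]
    have h6 := dist_triangle_right x y (d k)
    have h7 := hq.2
    change dist x (d k) < _ at h7
    linarith
  let E : X → (ULift.{u} ℕ → Icc (0:ℝ) 1) := fun x k => ⟨e k.down x, he _ _⟩
  have hE : Continuous E := continuous_pi fun k => (hc k.down).subtype_mk _
  have hEi : Function.Injective E := fun x y h => hi x y fun k =>
    congrArg Subtype.val (congrFun h ⟨k⟩)
  have hEc := hE.isClosedEmbedding hEi
  let hom : X ≃ₜ range E := hEc.isEmbedding.toHomeomorph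
  obtain ⟨U, hU, hAU, ρ, hρ, hρ'⟩ := hX (ULift.{u} ℕ → Icc (0:ℝ) 1) (range E) hEc.isClosed_range
    ⟨hom⟩
  let c : (ℕ → ℝ) → (ULift.{u} ℕ → Icc (0:ℝ) 1) := fun v k => projIcc 0 1 zero_le_one (v k.down)
  have hcc : Continuous c := continuous_pi fun k =>
    continuous_projIcc.comp (continuous_apply k.down)
  have hcE : ∀ x, c (fun k => e k x) = E x := fun x => by
    funext k
    exact projIcc_of_mem _ (he _ _)
  let r : (ℕ → ℝ) → X := fun v => if h : c v ∈ U then hom.symm ⟨ρ ⟨c v, h⟩, hρ _⟩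
    else Classical.arbitrary X
  refine ⟨e, he, hl, c ⁻¹' U, hU.preimage hcc, r, ?_, fun x => ⟨?_, ?_⟩⟩
  · rw [continuousOn_iff_continuous_domRestrict]
    have : (c ⁻¹' U).domRestrict r = fun v => hom.symm ⟨ρ ⟨c v.1, v.2⟩, hρ _⟩ := by
      funext v
      have hv : c v.1 ∈ U := v.2
      exact dif_pos hv
    rw [this]
    refine hom.symm.continuous.comp (Continuous.subtype_mk (ρ.continuous.comp ?_) _)
    exact Continuous.subtype_mk (hcc.comp continuous_subtype_val) _
  · rw [mem_preimage, hcE]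
    exact hAU ⟨x, rfl⟩
  · have hx : c (fun k => e k x) ∈ U := by rw [hcE]; exact hAU ⟨x, rfl⟩
    simp only [r, dif_pos hx]
    rw [Homeomorph.symm_apply_eq]
    apply Subtype.ext
    have h1 := hρ' ⟨c (fun k => e k x), hx⟩ ⟨x, (hcE x).symm⟩
    simp only at h1 ⊢
    rw [h1, hcE]
    rfl

theorem exists_setup {X Z : Type*} [MetricSpace X] [CompactSpace X] [MetricSpace Z]
    [CompactSpace Z] (A : Set Z) (hA : IsClosed A) (hne : A.Nonempty)
    (f : {μ : C(X, ℝ) → ℝ // IsIf μ} ≃ₜ A) :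
    ∃ (τ : Z → ℝ) (P : Z → X → ℝ) (ν : Z → {μ : C(X, ℝ) → ℝ // IsIf μ}),
      Continuous τ ∧ (∀ z, 0 ≤ τ z) ∧ (∀ z, τ z = 0 ↔ z ∈ A) ∧
      Continuous (fun p : Z × X => P p.1 p.2) ∧
      (∀ z w, τ z < 1 → |P z w - hat (ν z) (tent w (τ z ^ 2))| ≤ τ z ^ 3 / 2) ∧
      ∀ z, dist z (f (ν z) : Z) ≤ τ z ^ 3 / 2 := by
  let H : C(A × X × Icc (0:ℝ) 1, ℝ) :=
    ⟨fun p => hat (f.symm p.1) (tent p.2.1 p.2.2), hat_tent_cont.comp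
      (show Continuous fun p : A × X × Icc (0:ℝ) 1 => (f.symm p.1, p.2.1, (p.2.2 : ℝ)) by fun_prop)⟩
  have hemb : IsClosedEmbedding (fun p : A × X × Icc (0:ℝ) 1 => ((p.1 : Z), p.2)) := by
    have : CompactSpace A := isCompact_iff_compactSpace.1 hA.isCompact
    apply Continuous.isClosedEmbedding
    · fun_prop
    · rintro ⟨a, b⟩ ⟨a', b'⟩ h
      simp only [Prod.mk.injEq] at h
      exact Prod.ext (Subtype.ext h.1) h.2
  obtain ⟨K, hK⟩ := ContinuousMap.exists_extension hemb H
  have hK' : ∀ (a : A) w ρ, K ((a : Z), w, ρ) = hat (f.symm a) (tent w ρ) := fun a w ρ =>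
    DFunLike.congr_fun hK (a, w, ρ)
  let j : Z → C(X × Icc (0:ℝ) 1, ℝ) × Z := fun z => (K.curry z, z)
  have hj : Continuous j := by fun_prop
  have hJ : IsCompact (j '' A) := hA.isCompact.image hj
  have hJne : (j '' A).Nonempty := hne.image j
  let ε : Z → ℝ := fun z => Metric.infDist (j z) (j '' A)
  have hε : Continuous ε := (Metric.continuous_infDist_pt _).comp hj
  have hε0 : ∀ z, 0 ≤ ε z := fun z => Metric.infDist_nonneg
  have hεz : ∀ z, ε z = 0 ↔ z ∈ A := by
    intro z
    show Metric.infDist (j z) (j '' A) = 0 ↔ _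
    rw [← hJ.isClosed.mem_iff_infDist_zero hJne]
    constructor
    · rintro ⟨a, ha, h⟩
      have : a = z := congrArg Prod.snd h
      rwa [← this]
    · intro h; exact ⟨z, h, rfl⟩
  have hν : ∀ z, ∃ a : A, dist (j z) (j a) = ε z := by
    intro z
    obtain ⟨_, ⟨a, ha, rfl⟩, h⟩ := hJ.exists_infDist_eq_dist hJne (j z)
    exact ⟨⟨a, ha⟩, h.symm⟩
  choose ν hν using hν
  let τ : Z → ℝ := fun z => (2 * ε z) ^ (1 / 3 : ℝ)
  have hτ0 : ∀ z, 0 ≤ τ z := fun z => by have := hε0 z; positivity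
  have hτ3 : ∀ z, τ z ^ 3 / 2 = ε z := by
    intro z
    have : τ z ^ 3 = 2 * ε z := by
      have h1 := hε0 z
      show ((2 * ε z) ^ (1 / 3 : ℝ)) ^ 3 = _
      rw [← Real.rpow_natCast, ← Real.rpow_mul (by positivity)]
      norm_num
    linarith
  refine ⟨τ, fun z w => K (z, w, projIcc 0 1 zero_le_one (τ z ^ 2)), fun z => f.symm (ν z),
    ?_, hτ0, ?_, ?_, ?_, ?_⟩
  · exact Continuous.rpow_const (by fun_prop) (fun z => Or.inr (by norm_num))
  · intro z
    rw [← hεz, ← hτ3]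
    constructor
    · intro h; rw [h]; norm_num
    · intro h
      have : τ z ^ 3 = 0 := by linarith
      exact pow_eq_zero_iff (by norm_num) |>.1 this
  · have hτ : Continuous τ := Continuous.rpow_const (by fun_prop) (fun z => Or.inr (by norm_num))
    have : Continuous fun p : Z × X => projIcc (0:ℝ) 1 zero_le_one (τ p.1 ^ 2) :=
      continuous_projIcc.comp (by fun_prop)
    fun_prop
  · intro z w hz
    have hm : τ z ^ 2 ∈ Icc (0:ℝ) 1 := ⟨by positivity, pow_le_one₀ (hτ0 z) hz.le⟩
    rw [hτ3, ← hν z]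
    beta_reduce
    rw [projIcc_of_mem _ hm]
    have h1 := hK' (ν z) w ⟨τ z ^ 2, hm⟩
    simp only at h1
    rw [← h1, ← Real.dist_eq]
    have h2 := ContinuousMap.dist_apply_le_dist (f := K.curry z) (g := K.curry (ν z))
      (w, (⟨τ z ^ 2, hm⟩ : Icc (0:ℝ) 1))
    exact h2.trans (le_max_left _ _)
  · intro z
    rw [hτ3, ← hν z]
    simp only [Homeomorph.apply_symm_apply]
    exact le_max_right _ _

theorem gk_DD_cont {X T : Type*} [MetricSpace X] [CompactSpace X] [TopologicalSpace T]
    (e : X → ℝ) (he : Continuous e) (τ : T → ℝ) (P : T → X → ℝ) (c1 : Continuous τ)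
    (c2 : Continuous fun p : T × X => P p.1 p.2) (hτ : ∀ t, 0 < τ t) :
    Continuous fun p : T × X =>
      gk e (fun v => DD (τ p.1) (P p.1 v / τ p.1 ^ 2)) (4 * τ p.1 ^ 2) p.2 := by
  refine gk_cont e he (fun t v => DD (τ t) (P t v / τ t ^ 2)) ?_ (fun t => 4 * τ t ^ 2) ?_ ?_
  · unfold DD
    have c3 : ∀ p : T × X, τ p.1 ≠ 0 := fun p => (hτ _).ne'
    have c1' : Continuous fun p : T × X => τ p.1 := c1.comp continuous_fst
    have c4 : Continuous fun p : T × X => P p.1 p.2 / τ p.1 ^ 2 / τ p.1 :=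
      (c2.div (c1'.pow 2) (fun p => pow_ne_zero 2 (c3 p))).div c1' c3
    exact (continuous_const.mul (c1'.pow 2)).mul (continuous_const.max (continuous_const.sub c4))
  · fun_prop
  · intro t
    have := hτ t
    positivity

theorem g_exists {X Z : Type*} [MetricSpace X] [CompactSpace X] [MetricSpace Z]
    (A : Set Z) (hA : IsClosed A) (τ : Z → ℝ) (P : Z → X → ℝ)
    (ν : Z → {μ : C(X, ℝ) → ℝ // IsIf μ}) (hτ : Continuous τ) (hτ0 : ∀ z, 0 ≤ τ z)
    (hτA : ∀ z, τ z = 0 ↔ z ∈ A) (hP : Continuous (fun p : Z × X => P p.1 p.2))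
    (hap : ∀ z, z ∉ A → τ z < 1 / 100 → Approx (theRep (ν z)) (τ z) (fun w => P z w / τ z ^ 2))
    (e : ℕ → X → ℝ) (he : ∀ k x, e k x ∈ Icc (0:ℝ) 1)
    (hel : ∀ k x y, e k x ≤ e k y + dist x y) :
    ∃ g : Z → X → ℕ → ℝ, Continuous (fun p : Z × X => g p.1 p.2) ∧
      (∀ z ∈ A, ∀ x, g z x = fun k => e k x) ∧
      ∀ z, z ∉ A → ∀ w w', DD (τ z) (P z w / τ z ^ 2) ≤ 4 * τ z ^ 2 →
        DD (τ z) (P z w' / τ z ^ 2) ≤ 4 * τ z ^ 2 → dist w w' ≤ 4 * τ z ^ 2 → g z w = g z w' := by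
  classical
  have hpos : ∀ z, z ∉ A → 0 < τ z := fun z hz =>
    lt_of_le_of_ne (hτ0 z) (fun h => hz ((hτA z).1 h.symm))
  have hec : ∀ k, Continuous (e k) := by
    intro k
    apply LipschitzWith.continuous (K := 1)
    apply LipschitzWith.of_le_add
    exact hel k
  let g : Z → X → ℕ → ℝ := fun z x k => if z ∈ A then e k x else
    gk (e k) (fun v => DD (τ z) (P z v / τ z ^ 2)) (4 * τ z ^ 2) x
  have gA : ∀ z ∈ A, ∀ x, g z x = fun k => e k x := fun z hz x => by
    funext k; exact if_pos hz
  have gA' : ∀ z, z ∉ A → ∀ x k, g z x k =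
    gk (e k) (fun v => DD (τ z) (P z v / τ z ^ 2)) (4 * τ z ^ 2) x := fun z hz x k => if_neg hz
  refine ⟨g, ?_, gA, ?_⟩
  · refine continuous_pi fun k => ?_
    rw [continuous_iff_continuousAt]
    rintro ⟨z0, x0⟩
    by_cases hz0 : z0 ∈ A
    · have h1 : Filter.Tendsto (fun p : Z × X => e k p.2) (𝓝 (z0, x0)) (𝓝 (g z0 x0 k)) := by
        rw [gA z0 hz0]
        exact ((hec k).comp continuous_snd).continuousAt (x := (z0, x0))
      refine tendsto_of_tendsto_of_dist h1 ?_
      have h2 : Filter.Tendsto (fun p : Z × X => 20 * τ p.1) (𝓝 (z0, x0)) (𝓝 0) := by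
        have : Continuous fun p : Z × X => 20 * τ p.1 := by fun_prop
        have h3 := this.continuousAt (x := (z0, x0))
        unfold ContinuousAt at h3
        simp only [(hτA z0).2 hz0, mul_zero] at h3
        exact h3
      have h4 : ∀ᶠ p : Z × X in 𝓝 (z0, x0), τ p.1 < 1 / 100 := by
        have : IsOpen {p : Z × X | τ p.1 < 1 / 100} := isOpen_lt (by fun_prop) continuous_const
        apply this.mem_nhds
        show τ z0 < 1 / 100
        rw [(hτA z0).2 hz0]; norm_num
      refine squeeze_zero' (Filter.Eventually.of_forall fun _ => dist_nonneg) ?_ h2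
      filter_upwards [h4] with p hp
      by_cases hz : p.1 ∈ A
      · rw [gA _ hz, dist_self]
        have := hτ0 p.1
        positivity
      · rw [gA' _ hz]
        have ht := hpos _ hz
        have h5 := gk_near (e k) (he k) (fun v => DD (τ p.1) (P p.1 v / τ p.1 ^ 2))
          (4 * τ p.1 ^ 2) (by positivity) p.2 (20 * τ p.1) (by positivity) (fun w hw => by
            have := approx_near (hap _ hz hp) p.2 w hw
            linarith [hel k p.2 w])
        rw [Real.dist_eq, abs_le]
        constructor <;> linarith [h5.1, h5.2]
    · have hemb : IsOpenEmbedding (Prod.map (Subtype.val : ↥(Aᶜ) → Z) (id : X → X)) :=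
        hA.isOpen_compl.isOpenEmbedding_subtypeVal.prodMap IsOpenEmbedding.id
      have h1 := gk_DD_cont (T := ↥(Aᶜ)) (e k) (hec k) (fun t => τ t) (fun t x => P t x)
        (hτ.comp continuous_subtype_val)
        (hP.comp (continuous_subtype_val.prodMap continuous_id)) (fun t => hpos _ t.2)
      have h2 : (fun p : Z × X => g p.1 p.2 k) ∘ (Prod.map (Subtype.val : ↥(Aᶜ) → Z) (id : X → X))
          = fun p : ↥(Aᶜ) × X =>
          gk (e k) (fun v => DD (τ p.1) (P p.1 v / τ p.1 ^ 2)) (4 * τ p.1 ^ 2) p.2 := by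
        funext p
        exact gA' _ p.1.2 _ _
      have h3 := (hemb.continuousAt_iff (g := fun p : Z × X => g p.1 p.2 k)
        (x := ((⟨z0, hz0⟩ : ↥(Aᶜ)), x0))).1 (by rw [h2]; exact h1.continuousAt)
      exact h3
  · intro z hz w w' h1 h2 h3
    have := hpos z hz
    funext k
    rw [gA' _ hz, gA' _ hz]
    exact gk_eq (e k) (he k) _ _ (by positivity) w w' h1 h2 h3

theorem sup_cont {X Z : Type*} [MetricSpace X] [CompactSpace X] [MetricSpace Z]
    (O : Set Z) (hO : IsOpen O) (K : Z → X → ℝ)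
    (hK : ∀ z ∈ O, ∀ x, ContinuousAt (fun p : Z × X => K p.1 p.2) (z, x)) (z0 : Z) (hz0 : z0 ∈ O) :
    ContinuousAt (fun z => ⨆ w, K z w) z0 := by
  have hemb := hO.isOpenEmbedding_subtypeVal
  have h1 : Continuous fun p : O × X => K p.1 p.2 := by
    rw [continuous_iff_continuousAt]
    rintro ⟨t, x⟩
    exact ContinuousAt.comp (x := (t, x)) (g := fun p : Z × X => K p.1 p.2)
      (f := fun p : O × X => ((p.1 : Z), p.2)) (hK t t.2 x)
      (by fun_prop : Continuous fun p : O × X => ((p.1 : Z), p.2)).continuousAt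
  have h2 := IsCompact.continuous_sSup (f := fun (t : O) (w : X) => K t w)
    (isCompact_univ (X := X)) h1
  have h3 : Continuous ((fun z => ⨆ w, K z w) ∘ (Subtype.val : O → Z)) := by
    simp only [image_univ, sSup_range] at h2
    exact h2
  exact (hemb.continuousAt_iff (x := (⟨z0, hz0⟩ : O))).1 h3.continuousAt

theorem anr_main (X Z : Type u) [MetricSpace X] [CompactSpace X] [MetricSpace Z]
    [CompactSpace Z] (hX : IsCompactANR X) (A : Set Z) (hA : IsClosed A) (hne : A.Nonempty)
    (f : {μ : C(X, ℝ) → ℝ // IsIf μ} ≃ₜ A) : ∃ U : Set Z, IsOpen U ∧ A ⊆ U ∧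
      ∃ ρ : C(U, Z), (∀ u : U, ρ u ∈ A) ∧ ∀ u : U, (u : Z) ∈ A → ρ u = (u : Z) := by
  classical
  have hneX : Nonempty X := by
    obtain ⟨a, ha⟩ := hne
    exact ⟨(theRep (f.symm ⟨a, ha⟩)).x (theRep (f.symm ⟨a, ha⟩)).i0⟩
  obtain ⟨τ, P, ν, hτ, hτ0, hτA, hP, hPν, hν⟩ := exists_setup A hA hne f
  obtain ⟨e, he, hel, V, hV, r, hr, hre⟩ := anr_Q X hX
  have hpos : ∀ z, z ∉ A → 0 < τ z := fun z hz =>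
    lt_of_le_of_ne (hτ0 z) (fun h => hz ((hτA z).1 h.symm))
  have hap : ∀ z, z ∉ A → τ z < 1 / 100 →
      Approx (theRep (ν z)) (τ z) (fun w => P z w / τ z ^ 2) := fun z hz ht =>
    approx_of (ν z) (hpos z hz) ht (P z) (fun w => hPν z w (by linarith))
  obtain ⟨g, hg, hgA, hgeq⟩ := g_exists A hA τ P ν hτ hτ0 hτA hP hap e he hel
  let U : Set Z := {z | τ z < 1 / 100} ∩ {z | ∀ x, g z x ∈ V}
  have hU : IsOpen U := by
    refine (isOpen_lt hτ continuous_const).inter ?_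
    have hW : IsClosed ((fun p : Z × X => g p.1 p.2) ⁻¹' V)ᶜ := (hV.preimage hg).isClosed_compl
    have h1 := (isClosedMap_fst_of_compactSpace (X := Z) (Y := X) _ hW).isOpen_compl
    convert h1 using 1
    ext z
    simp
  have hAU : A ⊆ U := by
    intro z hz
    refine ⟨?_, fun x => ?_⟩
    · show τ z < 1 / 100
      rw [(hτA z).2 hz]; norm_num
    · rw [hgA z hz]; exact (hre x).1
  let G : Z → X → X := fun z x => r (g z x)
  have hGc : ∀ z ∈ U, ∀ x, ContinuousAt (fun p : Z × X => G p.1 p.2) (z, x) := by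
    intro z hz x
    exact ContinuousAt.comp (f := fun p : Z × X => g p.1 p.2)
      (hr.continuousAt (hV.mem_nhds (hz.2 x))) hg.continuousAt
  have hGA : ∀ z ∈ A, ∀ x, G z x = x := fun z hz x => by
    show r (g z x) = x
    rw [hgA z hz]; exact (hre x).2
  let S : C(X, ℝ) → Z → ℝ := fun φ z => ⨆ w, kap (τ z) (P z w / τ z ^ 2) * exp (φ (G z w))
  let m : Z → C(X, ℝ) → ℝ := fun z φ => log (S φ z)
  have hm : ∀ z ∈ U, z ∉ A → IsIf (m z) ∧ ∀ φ, exp (m z φ) = S φ z := by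
    intro z hzU hz
    exact approx_isIf (hap z hz hzU.1) (G z)
      (fun w w' h1 h2 h3 => congrArg r (hgeq z hz w w' h1 h2 h3)) (m z) (fun φ => rfl)
  let F : Z → {μ : C(X, ℝ) → ℝ // IsIf μ} := fun z =>
    if h : z ∈ A then f.symm ⟨z, h⟩ else if h2 : IsIf (m z) then ⟨m z, h2⟩ else ν z
  have hFA : ∀ z (h : z ∈ A), F z = f.symm ⟨z, h⟩ := fun z h => dif_pos h
  have hFU : ∀ z ∈ U, z ∉ A → (F z).1 = m z := by
    intro z hzU hz
    have h2 := (hm z hzU hz).1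
    have : F z = ⟨m z, h2⟩ := by simp only [F, dif_neg hz, dif_pos h2]
    rw [this]
  have hνA : ∀ z (h : z ∈ A), ν z = f.symm ⟨z, h⟩ := by
    intro z h
    have h1 := hν z
    rw [(hτA z).2 h] at h1
    have h2 : z = f (ν z) := dist_le_zero.1 (h1.trans (by norm_num))
    rw [Homeomorph.eq_symm_apply]
    exact Subtype.ext h2.symm
  have hFc : ∀ z ∈ U, ContinuousAt F z := by
    intro z0 hz0
    refine tendsto_subtype_rng.2 (tendsto_pi_nhds.2 fun φ => ?_)
    suffices hs : Filter.Tendsto (fun z => exp ((F z).1 φ)) (𝓝 z0) (𝓝 (exp ((F z0).1 φ))) by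
      have h := hs.log (exp_pos _).ne'
      simp only [log_exp] at h
      exact h
    by_cases hzA : z0 ∈ A
    · have hνt : Filter.Tendsto (fun z => exp ((ν z).1 φ)) (𝓝 z0) (𝓝 (exp ((F z0).1 φ))) := by
        have h1 : Filter.Tendsto (fun z => (f (ν z) : Z)) (𝓝 z0) (𝓝 z0) := by
          refine tendsto_of_tendsto_of_dist Filter.tendsto_id ?_
          have h2 : Filter.Tendsto (fun z => τ z ^ 3 / 2) (𝓝 z0) (𝓝 0) := by
            have h3 := (by fun_prop : Continuous fun z => τ z ^ 3 / 2).tendsto z0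
            rw [(hτA z0).2 hzA] at h3
            simpa using h3
          exact squeeze_zero (fun _ => dist_nonneg) hν h2
        have h2 : Filter.Tendsto (fun z => f (ν z)) (𝓝 z0) (𝓝 ⟨z0, hzA⟩) :=
          tendsto_subtype_rng.2 h1
        have h3 := (f.symm.continuous.tendsto _).comp h2
        have h4 : Filter.Tendsto ν (𝓝 z0) (𝓝 (F z0)) := by
          rw [hFA z0 hzA]
          refine h3.congr fun z => ?_
          simp
        have h5 : Continuous fun y : {μ : C(X, ℝ) → ℝ // IsIf μ} => exp (y.1 φ) :=
          continuous_exp.comp ((continuous_apply φ).comp continuous_subtype_val)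
        exact (h5.tendsto _).comp h4
      refine tendsto_of_tendsto_of_dist hνt ?_
      rw [Metric.tendsto_nhds]
      intro ε hε
      have hM : ∀ w, exp (φ w) ≤ exp ‖φ‖ := fun w =>
        exp_le_exp.2 ((le_abs_self _).trans (φ.norm_coe_le_norm w))
      have hψ : Continuous fun w => exp (φ w) := by fun_prop
      obtain ⟨δ, hδ, hδ'⟩ := Metric.uniformContinuous_iff.1
        (CompactSpace.uniformContinuous_of_continuous hψ) (ε / 4) (by linarith)
      have e1 : ∀ᶠ z in 𝓝 z0, ∀ w ∈ (univ : Set X), |exp (φ (G z w)) - exp (φ w)| < ε / 4 := by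
        apply isCompact_univ.eventually_forall_of_forall_eventually
        intro w _
        have h1 : ContinuousAt (fun p : Z × X => |exp (φ (G p.1 p.2)) - exp (φ p.2)|) (z0, w) := by
          have h2 : ContinuousAt (fun p : Z × X => exp (φ (G p.1 p.2))) (z0, w) :=
            ContinuousAt.comp (f := fun p : Z × X => G p.1 p.2) hψ.continuousAt (hGc z0 hz0 w)
          exact (h2.sub (hψ.comp continuous_snd).continuousAt).abs
        refine h1.eventually_lt continuousAt_const ?_
        simp only [hGA z0 hzA, sub_self, abs_zero]
        linarith
      have e2 : ∀ᶠ z in 𝓝 z0, τ z ^ 2 < δ := by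
        refine (by fun_prop : Continuous fun z => τ z ^ 2).continuousAt.eventually_lt
          continuousAt_const ?_
        rw [(hτA z0).2 hzA]; simpa using hδ
      have e3 : ∀ᶠ z in 𝓝 z0, 7 / 2 * τ z * exp ‖φ‖ < ε / 4 := by
        refine (by fun_prop : Continuous fun z => 7 / 2 * τ z * exp ‖φ‖).continuousAt.eventually_lt
          continuousAt_const ?_
        rw [(hτA z0).2 hzA]; simpa using hε
      filter_upwards [e1, e2, e3, hU.mem_nhds hz0] with z h1 h2 h3 h4
      rw [Real.dist_eq, sub_zero, abs_of_nonneg dist_nonneg]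
      by_cases hz : z ∈ A
      · rw [hFA z hz, hνA z hz, dist_self]; exact hε
      · have h5 := approx_est (ν z) (hap z hz h4.1) (G z) φ (ε / 4) (ε / 4) (exp ‖φ‖)
          (fun w => (h1 w (mem_univ _)).le)
          (fun w w' hw => (hδ' (hw.trans_lt h2)).le) (by linarith) hM
        rw [hFU z h4 hz, (hm z h4 hz).2 φ, dist_comm, Real.dist_eq]
        refine lt_of_le_of_lt h5 ?_
        linarith
    · have hO : IsOpen (U ∩ Aᶜ) := hU.inter hA.isOpen_compl
      have h1 : ContinuousAt (S φ) z0 := by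
        apply sup_cont (U ∩ Aᶜ) hO _ _ z0 ⟨hz0, hzA⟩
        intro z hz x
        have h2 : ContinuousAt (fun p : Z × X => exp (φ (G p.1 p.2))) (z, x) :=
          ContinuousAt.comp (f := fun p : Z × X => G p.1 p.2) (g := fun w => exp (φ w))
            (by fun_prop : Continuous fun w => exp (φ w)).continuousAt (hGc z hz.1 x)
        refine ContinuousAt.mul ?_ h2
        have c1 : ContinuousAt (fun p : Z × X => τ p.1) (z, x) := by fun_prop
        have c2 : ContinuousAt (fun p : Z × X => P p.1 p.2 / τ p.1 ^ 2) (z, x) :=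
          hP.continuousAt.div (c1.pow 2) (pow_ne_zero 2 (hpos z hz.2).ne')
        unfold kap
        fun_prop
      have h3 : S φ z0 = exp ((F z0).1 φ) := by rw [hFU z0 hz0 hzA, (hm z0 hz0 hzA).2]
      rw [← h3]
      refine Filter.Tendsto.congr' ?_ h1
      filter_upwards [hO.mem_nhds ⟨hz0, hzA⟩] with z hz
      rw [hFU z hz.1 hz.2, (hm z hz.1 hz.2).2]
  refine ⟨U, hU, hAU, ⟨fun u => (f (F u) : Z), ?_⟩, fun u => (f (F u)).2, fun u hu => ?_⟩
  · rw [continuous_iff_continuousAt]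
    intro u
    have h1 : ContinuousAt (fun u : U => F u) u :=
      ContinuousAt.comp (hFc u u.2) continuous_subtype_val.continuousAt
    exact (continuous_subtype_val.comp f.continuous).continuousAt.comp h1
  · show (f (F u) : Z) = u
    rw [hFA _ hu, Homeomorph.apply_symm_apply]

/-- if `X` is a compact metrizable ANR, then `I_f(X)` is a compact
metrizable ANR as well. -/
theorem stmt16 (X : Type u) [TopologicalSpace X] [CompactSpace X]
    [TopologicalSpace.MetrizableSpace X] (hX : IsCompactANR X) :
    CompactSpace {μ : C(X, ℝ) → ℝ // IsIf μ} ∧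
    TopologicalSpace.MetrizableSpace {μ : C(X, ℝ) → ℝ // IsIf μ} ∧
    IsCompactANR {μ : C(X, ℝ) → ℝ // IsIf μ} := by
  refine ⟨compact_If X, metrizable_If X, ?_⟩
  intro Z _ _ _ A' hA' hf
  obtain ⟨f⟩ := hf
  let _ := TopologicalSpace.metrizableSpaceMetric X
  let _ := TopologicalSpace.metrizableSpaceMetric Z
  rcases A'.eq_empty_or_nonempty with h | h
  · subst h
    exact ⟨∅, isOpen_empty, subset_rfl, ⟨fun u => u.1, continuous_subtype_val⟩,
      fun u => u.2.elim, fun u _ => rfl⟩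
  · exact anr_main X Z hX A' hA' h f
end
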